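/- arXiv:math/0601162 — 2 statements merged into one kernel-verified Lean document; each statement's English description precedes it below -/
import Mathlib

section
/- Let n ≥ 1 and define γ_1 = 2 and γ_n = 2n(1 + γ_{n-1}) for n > 1. Let Q be a cube in ℝ^n of side length b > 0 that is subdivided into q^n identical closed subcubes of side b/q (indexed by multi-indices j ∈ {0,…,q−1}^n), and let Y = {y_j} be a set of q^n points obtained by selecting one point y_j from each subcube. If q ≥ γ_n(k+1), then for every polynomial p in n real variables of total degree at most k, sup_{x ∈ Q} |p(x)| ≤ e^{2nγ_n(k+1)} · sup_{j} |p(y_j)|. -/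
/-- `γ₁ = 2` and `γₙ = 2n(1 + γₙ₋₁)` for `n > 1`. -/
def gammaMN : ℕ → ℝ
  | 0 => 0
  | 1 => 2
  | (n + 2) => 2 * (n + 2) * (1 + gammaMN (n + 1))

open Polynomial in
lemma poly_max_disc (G : ℂ[X]) (M : ℝ) (h : ∀ z : ℂ, ‖z‖ = 1 → ‖G.eval z‖ ≤ M) (z : ℂ)
    (hz : ‖z‖ ≤ 1) : ‖G.eval z‖ ≤ M := by
  refine Complex.norm_le_of_forall_mem_frontier_norm_le (U := Metric.ball (0:ℂ) 1)
    Metric.isBounded_ball (f := fun z => G.eval z) ?_ ?_ ?_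
  · exact (Polynomial.differentiable G).diffContOnCl
  · intro w hw
    rw [frontier_ball _ one_ne_zero] at hw
    exact h w (by simpa using hw)
  · rw [closure_ball _ one_ne_zero]; simpa using hz

lemma re_aux (z r : ℂ) (hz : ‖z‖ = 1) (hr : 1 < ‖r‖) : (z * (1 / (z - r))).re < 1 / 2 := by
  have h1 : z.re * z.re + z.im * z.im = 1 := by
    have := Complex.sq_norm z
    rw [hz, Complex.normSq_apply] at this; linarith
  have h2 : 1 < r.re * r.re + r.im * r.im := by
    have := Complex.sq_norm r
    rw [Complex.normSq_apply] at this; nlinarith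
  have h3 : 0 < (z.re - r.re) * (z.re - r.re) + (z.im - r.im) * (z.im - r.im) := by
    by_contra hcon
    have e1 : z.re - r.re = 0 := by nlinarith [mul_self_nonneg (z.re - r.re), mul_self_nonneg (z.im - r.im)]
    have e2 : z.im - r.im = 0 := by nlinarith [mul_self_nonneg (z.re - r.re), mul_self_nonneg (z.im - r.im)]
    have e1' : r.re = z.re := by linarith
    have e2' : r.im = z.im := by linarith
    rw [e1', e2'] at h2; linarith
  rw [mul_one_div, Complex.div_re, Complex.normSq_apply]
  simp only [Complex.sub_re, Complex.sub_im]
  rw [← add_div, div_lt_div_iff₀ h3 (by norm_num)]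
  nlinarith

open Polynomial in
lemma bern_poly (G : ℂ[X]) (N : ℕ) (hG : G.natDegree ≤ N) (M : ℝ)
    (h : ∀ z : ℂ, ‖z‖ = 1 → ‖G.eval z‖ ≤ M) (z : ℂ) (hz : ‖z‖ = 1) :
    ‖(C 2 * X * derivative G - C (N : ℂ) * G).eval z‖ ≤ N * M := by
  rcases Nat.eq_zero_or_pos N with hN | hN
  · subst hN
    have : G = C (G.coeff 0) := eq_C_of_natDegree_le_zero hG
    rw [this]; simp
  by_contra hcon
  push Not at hcon
  have hN' : (0:ℝ) < N := by exact_mod_cast hN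
  have hNc : (N : ℂ) ≠ 0 := by exact_mod_cast hN.ne'
  set V := (C 2 * X * derivative G - C (N : ℂ) * G).eval z with hV
  set μ : ℂ := - V / N with hμ
  have hμM : M < ‖μ‖ := by
    rw [hμ, norm_div, norm_neg, Complex.norm_natCast, lt_div_iff₀ hN']; linarith
  set K := G - C μ with hK
  have hroot : ∀ w : ℂ, ‖w‖ ≤ 1 → K.eval w ≠ 0 := by
    intro w hw h0
    have := poly_max_disc G M h w hw
    have e : G.eval w = μ := by
      simpa [hK, sub_eq_zero] using h0
    rw [e] at this; linarith
  have hKz : K.eval z ≠ 0 := hroot z hz.le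
  have hlog := (IsAlgClosed.splits K).eval_derivative_div_eval_of_ne_zero hKz
  have hdeg : K.natDegree ≤ N := by
    rw [hK, natDegree_sub_C]; exact hG
  have hcard : K.roots.card ≤ N := (card_roots' K).trans hdeg
  have hall : ∀ r ∈ K.roots, 1 < ‖r‖ := by
    intro r hr
    by_contra hc
    exact hroot r (not_lt.mp hc) (isRoot_of_mem_roots hr)
  have hsum : ∀ s : Multiset ℂ, (∀ r ∈ s, 1 < ‖r‖) →
      s = 0 ∨ (z * (s.map fun r => 1 / (z - r)).sum).re < s.card / 2 := by
    intro s
    induction s using Multiset.induction with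
    | empty => intro _; left; rfl
    | cons a s ih =>
      intro hs
      right
      have ha := re_aux z a hz (hs a (Multiset.mem_cons_self a s))
      rw [Multiset.map_cons, Multiset.sum_cons, mul_add, Complex.add_re, Multiset.card_cons]
      push_cast
      rcases ih (fun r hr => hs r (Multiset.mem_cons_of_mem hr)) with h0 | h0
      · subst h0; simp only [Multiset.map_zero, Multiset.sum_zero, mul_zero, Complex.zero_re, Multiset.card_zero]
        push_cast; linarith
      · linarith
  have hval : z * (K.derivative.eval z / K.eval z) = N / 2 := by
    have e1 : K.derivative = G.derivative := by simp [hK]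
    have e2 : 2 * z * G.derivative.eval z - N * K.eval z = 0 := by
      have : K.eval z = G.eval z - μ := by simp [hK]
      rw [this, hμ]
      have hVe : V = 2 * z * G.derivative.eval z - N * G.eval z := by simp [hV]
      field_simp
      rw [hVe]; ring
    rw [e1]
    field_simp
    linear_combination e2
  rw [hlog] at hval
  have hre : (z * (K.roots.map fun r => 1 / (z - r)).sum).re < N / 2 := by
    rcases hsum K.roots hall with h0 | h0
    · rw [h0]; simpa using hN'
    · have : (K.roots.card : ℝ) ≤ N := by exact_mod_cast hcard
      linarith
  rw [hval] at hre
  have : ((N : ℂ) / 2).re = N / 2 := by simp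
  linarith

open Polynomial in
/-- `z^D P(L (z + 1/z)/2)` as a polynomial. -/
noncomputable def jouk (P : ℝ[X]) (L : ℝ) (D : ℕ) : ℂ[X] :=
  ∑ i ∈ Finset.range (D + 1), C ((P.coeff i * L ^ i : ℝ) : ℂ) * (C (1/2) * (X ^ 2 + 1)) ^ i * X ^ (D - i)

open Polynomial in
lemma jouk_deg (P : ℝ[X]) (L : ℝ) (D : ℕ) : (jouk P L D).natDegree ≤ 2 * D := by
  unfold jouk
  refine natDegree_sum_le_of_forall_le _ _ ?_
  intro i hi
  have hi' : i ≤ D := by simpa [Nat.lt_succ_iff] using hi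
  have h1 : (C (1/2 : ℂ) * (X ^ 2 + 1)).natDegree ≤ 2 := by compute_degree
  have h2 : ((C (1/2 : ℂ) * (X ^ 2 + 1)) ^ i).natDegree ≤ i * 2 := natDegree_pow_le_of_le i h1
  have h3 := natDegree_mul_le (p := C ((P.coeff i * L ^ i : ℝ) : ℂ) * (C (1/2) * (X ^ 2 + 1)) ^ i) (q := (X : ℂ[X]) ^ (D - i))
  have h4 := natDegree_C_mul_le ((P.coeff i * L ^ i : ℝ) : ℂ) ((C (1/2 : ℂ) * (X ^ 2 + 1)) ^ i)
  have h5 : ((X : ℂ[X]) ^ (D - i)).natDegree = D - i := natDegree_X_pow _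
  omega

open Polynomial in
lemma jouk_eval (P : ℝ[X]) (L : ℝ) (D : ℕ) (hP : P.natDegree ≤ D) (z : ℂ) (hz : z ≠ 0) (x : ℝ)
    (hx : (z + z⁻¹) / 2 = (x : ℂ)) :
    (jouk P L D).eval z = z ^ D * ((P.eval (L * x) : ℝ) : ℂ) := by
  unfold jouk
  rw [eval_finsetSum, P.eval_eq_sum_range' (Nat.lt_succ_of_le hP)]
  push_cast
  rw [Finset.mul_sum]
  refine Finset.sum_congr rfl ?_
  intro i hi
  have hi' : i ≤ D := by simpa [Nat.lt_succ_iff] using hi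
  have e : z ^ 2 + 1 = 2 * z * x := by
    rw [← hx]; field_simp
  simp only [eval_mul, eval_C, eval_pow, eval_add, eval_X, eval_one]
  rw [e]
  obtain ⟨d, rfl⟩ := Nat.exists_eq_add_of_le hi'
  rw [Nat.add_sub_cancel_left]
  have e2 : (1/2 : ℂ) * (2 * z * x) = z * x := by ring
  rw [e2]
  push_cast
  rw [mul_pow, mul_pow, pow_add]; ring

/-- `e^{-iDθ} G(e^{iθ})`. -/
noncomputable def tau (G : Polynomial ℂ) (D : ℕ) (θ : ℝ) : ℂ :=
  Complex.exp (-(D * (θ * Complex.I))) * G.eval (Complex.exp (θ * Complex.I))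

open Polynomial in
lemma tau_deriv (G : ℂ[X]) (D : ℕ) (θ : ℝ) :
    HasDerivAt (tau G D)
      (Complex.I / 2 * tau (C 2 * X * derivative G - C ((2 * D : ℕ) : ℂ) * G) D θ) θ := by
  have h0 : HasDerivAt (fun t : ℝ => (t : ℂ) * Complex.I) Complex.I θ := by
    simpa using (Complex.ofRealCLM.hasDerivAt (x := θ)).mul_const Complex.I
  have h1 : HasDerivAt (fun t : ℝ => Complex.exp ((t : ℂ) * Complex.I))
      (Complex.exp (θ * Complex.I) * Complex.I) θ := h0.cexp
  have h2 : HasDerivAt (fun t : ℝ => Complex.exp (-(D * ((t : ℂ) * Complex.I))))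
      (Complex.exp (-(D * (θ * Complex.I))) * (-(D * Complex.I))) θ := ((h0.const_mul (D:ℂ)).neg).cexp
  have h3 : HasDerivAt (fun t : ℝ => G.eval (Complex.exp ((t : ℂ) * Complex.I)))
      (G.derivative.eval (Complex.exp (θ * Complex.I)) * (Complex.exp (θ * Complex.I) * Complex.I)) θ :=
    (G.hasDerivAt _).comp θ h1
  have h4 := h2.mul h3
  refine h4.congr_deriv ?_
  simp only [tau, eval_sub, eval_mul, eval_C, eval_X]
  push_cast
  ring

lemma tau_norm (G : Polynomial ℂ) (D : ℕ) (θ : ℝ) :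
    ‖tau G D θ‖ = ‖G.eval (Complex.exp (θ * Complex.I))‖ := by
  unfold tau
  rw [norm_mul, show -((D:ℂ) * (θ * Complex.I)) = ((-(D * θ) : ℝ) : ℂ) * Complex.I by push_cast; ring,
    Complex.norm_exp_ofReal_mul_I, one_mul]

lemma unit_eq (z : ℂ) (hz : ‖z‖ = 1) : Complex.exp (z.arg * Complex.I) = z := by
  have := Complex.norm_mul_exp_arg_mul_I z
  rwa [hz, Complex.ofReal_one, one_mul] at this

lemma cos_eq (θ : ℝ) : (Complex.exp (θ * Complex.I) + (Complex.exp (θ * Complex.I))⁻¹) / 2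
    = ((Real.cos θ : ℝ) : ℂ) := by
  rw [← Complex.exp_neg, Complex.ofReal_cos, Complex.cos]; ring_nf

open Polynomial in
lemma tau_jouk (P : ℝ[X]) (L : ℝ) (D : ℕ) (hP : P.natDegree ≤ D) (θ : ℝ) :
    tau (jouk P L D) D θ = ((P.eval (L * Real.cos θ) : ℝ) : ℂ) := by
  unfold tau
  rw [jouk_eval P L D hP _ (Complex.exp_ne_zero _) _ (cos_eq θ), ← mul_assoc, ← Complex.exp_nat_mul,
    ← Complex.exp_add]
  simp

open Polynomial in
lemma bern_trig (P : ℝ[X]) (L : ℝ) (D : ℕ) (hP : P.natDegree ≤ D) (M : ℝ)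
    (h : ∀ θ : ℝ, |P.eval (L * Real.cos θ)| ≤ M) (s t : ℝ) :
    |P.eval (L * Real.cos t) - P.eval (L * Real.cos s)| ≤ D * |t - s| * M ∧
    (|P.eval (L * Real.cos s)| = M →
      |P.eval (L * Real.cos t) - P.eval (L * Real.cos s)| ≤ (D * |t - s|) ^ 2 * M) := by
  set G := jouk P L D with hG
  set G1 := C 2 * X * derivative G - C ((2 * D : ℕ) : ℂ) * G with hG1
  set G2 := C 2 * X * derivative G1 - C ((2 * D : ℕ) : ℂ) * G1 with hG2
  have hGd : G.natDegree ≤ 2 * D := jouk_deg P L D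
  have hG1d : G1.natDegree ≤ 2 * D := by
    have hd : G.derivative.natDegree ≤ 2 * D - 1 := (natDegree_derivative_le G).trans (by omega)
    rw [hG1]
    refine (natDegree_sub_le _ _).trans (max_le ?_ ?_)
    · rcases Nat.eq_zero_or_pos D with h0 | h0
      · have : G.derivative = 0 := by
          rw [eq_C_of_natDegree_le_zero (p := G) (by omega)]; simp
        rw [this]; simp
      · have h1 : (C (2:ℂ) * X).natDegree ≤ 1 := by compute_degree
        have := natDegree_mul_le (p := C (2:ℂ) * X) (q := G.derivative)
        omega
    · exact (natDegree_C_mul_le _ _).trans hGd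
  have hb0 : ∀ z : ℂ, ‖z‖ = 1 → ‖G.eval z‖ ≤ M := by
    intro z hz
    rw [← unit_eq z hz, ← tau_norm G D, hG, tau_jouk P L D hP, Complex.norm_real]
    exact h _
  have hb1 : ∀ z : ℂ, ‖z‖ = 1 → ‖G1.eval z‖ ≤ (2 * D : ℕ) * M := bern_poly G (2 * D) hGd M hb0
  have hb2 : ∀ z : ℂ, ‖z‖ = 1 → ‖G2.eval z‖ ≤ (2 * D : ℕ) * ((2 * D : ℕ) * M) :=
    bern_poly G1 (2 * D) hG1d _ hb1
  have hd0 : ∀ θ : ℝ, HasDerivAt (tau G D) (Complex.I / 2 * tau G1 D θ) θ := tau_deriv G D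
  have hd1 : ∀ θ : ℝ, HasDerivAt (fun θ => Complex.I / 2 * tau G1 D θ)
      (Complex.I / 2 * (Complex.I / 2 * tau G2 D θ)) θ := fun θ => (tau_deriv G1 D θ).const_mul _
  have hI : ‖(Complex.I / 2 : ℂ)‖ = 1 / 2 := by simp
  have hn1 : ∀ θ : ℝ, ‖Complex.I / 2 * tau G1 D θ‖ ≤ D * M := by
    intro θ
    rw [norm_mul, hI, tau_norm]
    have := hb1 _ (Complex.norm_exp_ofReal_mul_I θ)
    push_cast at this; linarith
  have hn2 : ∀ θ : ℝ, ‖Complex.I / 2 * (Complex.I / 2 * tau G2 D θ)‖ ≤ D ^ 2 * M := by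
    intro θ
    rw [norm_mul, norm_mul, hI, tau_norm]
    have := hb2 _ (Complex.norm_exp_ofReal_mul_I θ)
    push_cast at this; linarith
  have hdiff : ∀ t s : ℝ, ‖tau G D t - tau G D s‖
      = |P.eval (L * Real.cos t) - P.eval (L * Real.cos s)| := by
    intro t s
    rw [hG, tau_jouk P L D hP, tau_jouk P L D hP, ← Complex.ofReal_sub, Complex.norm_real]; rfl
  have hM : 0 ≤ M := (abs_nonneg _).trans (h 0)
  rw [← hdiff]
  constructor
  · have := convex_univ.norm_image_sub_le_of_norm_hasDerivWithin_le (𝕜 := ℝ) (f := tau G D)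
      (fun x _ => (hd0 x).hasDerivWithinAt) (fun x _ => hn1 x) (Set.mem_univ s) (Set.mem_univ t)
    rw [Real.norm_eq_abs] at this; linarith
  · intro hmax
    have hz : Complex.I / 2 * tau G1 D s = 0 := by
      have hfd : HasDerivAt (fun θ : ℝ => P.eval (L * Real.cos θ))
          (P.derivative.eval (L * Real.cos s) * (L * -Real.sin s)) s :=
        (P.hasDerivAt _).comp s ((Real.hasDerivAt_cos s).const_mul L)
      have hfc := hfd.ofReal_comp
      have heq : (fun θ : ℝ => ((P.eval (L * Real.cos θ) : ℝ) : ℂ)) = tau G D := by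
        funext θ; exact (tau_jouk P L D hP θ).symm
      rw [heq] at hfc
      rw [(hd0 s).unique hfc]
      have h0 : P.derivative.eval (L * Real.cos s) * (L * -Real.sin s) = 0 := by
        rcases abs_choice (P.eval (L * Real.cos s)) with hc | hc
        · refine IsLocalMax.hasDerivAt_eq_zero (f := fun θ : ℝ => P.eval (L * Real.cos θ)) (a := s) ?_ hfd
          refine Filter.Eventually.of_forall fun x => ?_
          have := (le_abs_self _).trans (h x)
          simp only; linarith
        · refine IsLocalMin.hasDerivAt_eq_zero (f := fun θ : ℝ => P.eval (L * Real.cos θ)) (a := s) ?_ hfd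
          refine Filter.Eventually.of_forall fun x => ?_
          have := (neg_abs_le _).trans' (neg_le_neg (h x))
          simp only; linarith
      rw [h0]; simp
    have hl : ∀ x ∈ Set.uIcc s t, ‖Complex.I / 2 * tau G1 D x‖ ≤ D ^ 2 * M * |t - s| := by
      intro x hx
      have := convex_univ.norm_image_sub_le_of_norm_hasDerivWithin_le (𝕜 := ℝ)
        (f := fun θ => Complex.I / 2 * tau G1 D θ)
        (fun x _ => (hd1 x).hasDerivWithinAt) (fun x _ => hn2 x) (Set.mem_univ s) (Set.mem_univ x)
      simp only [hz, sub_zero] at this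
      refine this.trans ?_
      have : |x - s| ≤ |t - s| := Set.abs_sub_left_of_mem_uIcc hx
      rw [Real.norm_eq_abs]
      gcongr
    have := (convex_uIcc s t).norm_image_sub_le_of_norm_hasDerivWithin_le (𝕜 := ℝ) (f := tau G D)
      (fun x _ => (hd0 x).hasDerivWithinAt) hl Set.left_mem_uIcc Set.right_mem_uIcc
    rw [Real.norm_eq_abs] at this
    nlinarith

open Polynomial in
lemma localize_ge (g : ℝ[X]) (k : ℕ) (hg : g.natDegree ≤ k) (M : ℝ)
    (h : ∀ x : ℝ, |x| ≤ 1 → |g.eval x * (9/5 - x^2) ^ k| ≤ M) (x : ℝ) (hx1 : 1 ≤ x)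
    (hx2 : x ^ 2 ≤ 9/5) : |g.eval x * (9/5 - x^2) ^ k| ≤ M := by
  have hM : 0 ≤ M := (abs_nonneg _).trans (h 0 (by simp))
  -- w + 1/w = 2x, 0 < w ≤ 1
  obtain ⟨w, hw0, hw1, hwx⟩ : ∃ w : ℝ, 0 < w ∧ w ≤ 1 ∧ w ^ 2 + 1 = 2 * x * w := by
    have hs : Real.sqrt (x^2 - 1) ^ 2 = x^2 - 1 := Real.sq_sqrt (by nlinarith)
    have hs0 := Real.sqrt_nonneg (x^2 - 1)
    refine ⟨x - Real.sqrt (x^2 - 1), ?_, ?_, ?_⟩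
    · nlinarith
    · nlinarith
    · nlinarith
  set H : ℂ[X] := jouk g 1 k * (1 - C (1/5) * X ^ 2) ^ (2 * k) with hH
  have hcirc : ∀ z : ℂ, ‖z‖ = 1 → ‖H.eval z‖ ≤ (4/5) ^ k * M := by
    intro z hz
    rw [← unit_eq z hz]
    set θ := z.arg
    have h1 : ‖(jouk g 1 k).eval (Complex.exp (θ * Complex.I))‖ = |g.eval (Real.cos θ)| := by
      rw [← tau_norm _ k, tau_jouk g 1 k hg, Complex.norm_real, one_mul]; rfl
    have h2 : ‖1 - (1/5 : ℂ) * Complex.exp (θ * Complex.I) ^ 2‖ ^ 2 = 4/5 * (9/5 - Real.cos θ ^ 2) := by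
      rw [Complex.exp_mul_I, ← Complex.ofReal_cos, ← Complex.ofReal_sin, Complex.sq_norm,
        Complex.normSq_apply]
      have := Real.sin_sq_add_cos_sq θ
      have e : 1 - (1/5 : ℂ) * ((Real.cos θ : ℂ) + (Real.sin θ : ℂ) * Complex.I) ^ 2
          = ((1 - (Real.cos θ ^ 2 - Real.sin θ ^ 2) / 5 : ℝ) : ℂ)
            + ((- (2 * Real.cos θ * Real.sin θ) / 5 : ℝ) : ℂ) * Complex.I := by
        push_cast
        linear_combination (-(1/5 : ℂ) * (Complex.sin (θ : ℂ))^2) * Complex.I_sq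
      rw [e]
      simp only [Complex.add_re, Complex.add_im, Complex.ofReal_re, Complex.ofReal_im,
        Complex.re_ofReal_mul, Complex.im_ofReal_mul, Complex.I_re, Complex.I_im]
      have e2 : Real.sin θ ^ 2 = 1 - Real.cos θ ^ 2 := by linarith
      have : (1 - (Real.cos θ ^ 2 - Real.sin θ ^ 2) / 5) ^ 2
         + 4 * Real.cos θ ^ 2 * Real.sin θ ^ 2 / 25 = 4/5 * (9/5 - Real.cos θ ^ 2) := by
        rw [e2]; ring
      linarith
    rw [hH]
    simp only [eval_mul, eval_pow, eval_sub, eval_one, eval_C, eval_X]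
    rw [norm_mul, norm_pow, pow_mul, h2, h1, mul_pow]
    have := h (Real.cos θ) (Real.abs_cos_le_one θ)
    have hp : 0 ≤ 9/5 - Real.cos θ ^ 2 := by nlinarith [Real.cos_sq_le_one θ]
    rw [abs_mul, abs_of_nonneg (pow_nonneg hp k)] at this
    calc _ = (4/5 : ℝ) ^ k * (|g.eval (Real.cos θ)| * (9/5 - Real.cos θ ^ 2) ^ k) := by ring
      _ ≤ _ := by gcongr
  have hw := poly_max_disc H _ hcirc (w : ℂ) (by rw [Complex.norm_real, Real.norm_eq_abs, abs_of_pos hw0]; exact hw1)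
  have hwc : (w : ℂ) ≠ 0 := by exact_mod_cast hw0.ne'
  have hxe : ((w : ℂ) + (w : ℂ)⁻¹) / 2 = (x : ℂ) := by
    rw [← Complex.ofReal_inv, ← Complex.ofReal_add]
    have : (w + w⁻¹) / 2 = x := by field_simp; linarith
    rw [← this]; push_cast; ring
  have hev : ‖H.eval (w : ℂ)‖ = w ^ k * |g.eval x| * (1 - w^2/5) ^ (2 * k) := by
    rw [hH]
    simp only [eval_mul, eval_pow, eval_sub, eval_one, eval_C, eval_X]
    rw [jouk_eval g 1 k hg _ hwc x hxe, one_mul]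
    have : (1 - (1/5 : ℂ) * (w : ℂ)^2) = ((1 - w^2/5 : ℝ) : ℂ) := by push_cast; ring
    rw [this, norm_mul, norm_mul, norm_pow, norm_pow, Complex.norm_real, Complex.norm_real, Complex.norm_real,
      Real.norm_eq_abs, Real.norm_eq_abs, Real.norm_eq_abs, abs_of_pos hw0,
      abs_of_nonneg (show 0 ≤ 1 - w^2/5 by nlinarith)]
  rw [hev] at hw
  have hA : 0 < 1 - w^2/5 := by nlinarith
  -- 9/5 - x^2 ≤ (5/4) * w * (1 - w^2/5)^2
  have hkey : 9/5 - x^2 ≤ 5/4 * (w * (1 - w^2/5)^2) := by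
    have e : (9/5 - x^2) * w^2 = 5/4 * ((1 - w^2/5) * (w^2 - 1/5)) := by
      have : x^2 * w^2 = (w^2+1)^2/4 := by rw [hwx]; ring
      nlinarith
    have e3 : w^2 - 1/5 ≤ w^3 * (1 - w^2/5) := by
      have : 0 ≤ (1 - w)^3 * (w^2 + 3*w + 1) := by
        have : 0 ≤ 1 - w := by linarith
        positivity
      nlinarith
    have e4 : (9/5 - x^2) * w^2 ≤ 5/4 * (w * (1 - w^2/5)^2) * w^2 := by
      rw [e]
      have := mul_le_mul_of_nonneg_left e3 hA.le
      nlinarith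
    exact le_of_mul_le_mul_right e4 (by positivity)
  have hp : 0 ≤ 9/5 - x^2 := by linarith
  rw [abs_mul, abs_of_nonneg (pow_nonneg hp k)]
  calc |g.eval x| * (9/5 - x^2)^k ≤ |g.eval x| * (5/4 * (w * (1 - w^2/5)^2))^k := by gcongr
    _ = (5/4)^k * (w ^ k * |g.eval x| * (1 - w^2/5) ^ (2 * k)) := by
        rw [mul_pow, mul_pow, ← pow_mul]; ring
    _ ≤ (5/4)^k * ((4/5)^k * M) := by gcongr
    _ = M := by rw [← mul_assoc, ← mul_pow]; norm_num

open Polynomial in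
lemma localize (g : ℝ[X]) (k : ℕ) (hg : g.natDegree ≤ k) (M : ℝ)
    (h : ∀ x : ℝ, |x| ≤ 1 → |g.eval x * (9/5 - x^2) ^ k| ≤ M) (x : ℝ)
    (hx2 : x ^ 2 ≤ 9/5) : |g.eval x * (9/5 - x^2) ^ k| ≤ M := by
  rcases le_or_gt |x| 1 with h1 | h1
  · exact h x h1
  rcases le_or_gt 0 x with h0 | h0
  · exact localize_ge g k hg M h x (by rw [abs_of_nonneg h0] at h1; exact h1.le) hx2
  · have := localize_ge (g.comp (-X)) k (by rw [natDegree_comp]; simpa using hg) M (by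
      intro y hy
      have := h (-y) (by rwa [abs_neg])
      simpa using this) (-x) (by rw [abs_of_neg h0] at h1; exact h1.le) (by simpa using hx2)
    simpa using this

lemma angle_exists (x y : ℝ) (hx : |x| ≤ 1) (hy : |y| ≤ 1) : ∃ s t : ℝ,
    Real.sqrt (9/5) * Real.cos s = x ∧ Real.sqrt (9/5) * Real.cos t = y ∧
      |t - s| ≤ 1.12 * |y - x| := by
  set L := Real.sqrt (9/5) with hL
  have hL2 : L ^ 2 = 9/5 := Real.sq_sqrt (by norm_num)
  have hL0 : 0 ≤ L := Real.sqrt_nonneg _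
  have hL1 : 1 < L := by nlinarith
  have hb : ∀ x : ℝ, |x| ≤ 1 → -1 < x / L ∧ x / L < 1 := by
    intro x hx
    rw [abs_le] at hx
    constructor
    · rw [lt_div_iff₀ (by linarith)]; linarith
    · rw [div_lt_iff₀ (by linarith)]; linarith
  refine ⟨Real.arccos (x / L), Real.arccos (y / L), ?_, ?_, ?_⟩
  · rw [Real.cos_arccos (hb x hx).1.le (hb x hx).2.le]; field_simp
  · rw [Real.cos_arccos (hb y hy).1.le (hb y hy).2.le]; field_simp
  · have := (convex_Icc (-1:ℝ) 1).norm_image_sub_le_of_norm_hasDerivWithin_le (𝕜 := ℝ)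
      (f := fun u => Real.arccos (u / L)) (f' := fun u => -(1 / Real.sqrt (1 - (u/L)^2)) * (1 / L)) (C := 1.12)
      (fun u hu => ?_) (fun u hu => ?_) (abs_le.mp hx) (abs_le.mp hy)
    · simpa only [Real.norm_eq_abs] using this
    · have hu' := hb u (abs_le.mpr hu)
      exact ((Real.hasDerivAt_arccos hu'.1.ne' hu'.2.ne).comp u ((hasDerivAt_id u).div_const L)).hasDerivWithinAt
    · have hu' := abs_le.mpr hu
      have hu2 : u^2 ≤ 1 := by rw [← sq_abs]; nlinarith [abs_nonneg u]
      have e : Real.sqrt (1 - (u/L)^2) * L = Real.sqrt (9/5 - u^2) := by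
        have hh : 9/5 - u^2 = (1 - (u/L)^2) * L^2 := by field_simp; rw [hL2]; ring
        rw [hh, Real.sqrt_mul' _ (sq_nonneg L), Real.sqrt_sq hL0]
      rw [neg_mul, norm_neg, one_div_mul_one_div, e, Real.norm_eq_abs,
        abs_of_nonneg (by positivity)]
      have : (1/1.12 : ℝ) ≤ Real.sqrt (9/5 - u^2) := by
        apply Real.le_sqrt_of_sq_le; norm_num; linarith
      rw [div_le_iff₀ (by linarith [show (0:ℝ) < 1/1.12 by norm_num])]
      linarith [mul_le_mul_of_nonneg_left this (show (0:ℝ) ≤ 1.12 by norm_num)]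

open Polynomial in
lemma step_bound (g : ℝ[X]) (k : ℕ) (hg : g.natDegree ≤ k) (M : ℝ)
    (h : ∀ x : ℝ, |x| ≤ 1 → |g.eval x * (9/5 - x^2) ^ k| ≤ M) (x y : ℝ) (hx : |x| ≤ 1) (hy : |y| ≤ 1)
    (e : ℝ) (he : 3 * k * (1.12 * |y - x|) ≤ e) :
    |g.eval y * (9/5 - y^2) ^ k - g.eval x * (9/5 - x^2) ^ k| ≤ e * M ∧
    (|g.eval x * (9/5 - x^2) ^ k| = M →
      |g.eval y * (9/5 - y^2) ^ k - g.eval x * (9/5 - x^2) ^ k| ≤ e ^ 2 * M) := by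
  have hM : 0 ≤ M := (abs_nonneg _).trans (h 0 (by simp))
  set P : ℝ[X] := g * (C (9/5) - X^2) ^ k with hP
  have hPe : ∀ u : ℝ, P.eval u = g.eval u * (9/5 - u^2)^k := by intro u; simp [hP]
  have hPd : P.natDegree ≤ 3 * k := by
    have h1 : (C (9/5 : ℝ) - X^2).natDegree ≤ 2 := by compute_degree
    have h2 := natDegree_pow_le_of_le k h1
    have h3 := natDegree_mul_le (p := g) (q := (C (9/5 : ℝ) - X^2) ^ k)
    rw [hP]; omega
  obtain ⟨s, t, hs, ht, hst⟩ := angle_exists x y hx hy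
  have hbd : ∀ θ : ℝ, |P.eval (Real.sqrt (9/5) * Real.cos θ)| ≤ M := by
    intro θ
    rw [hPe]
    apply localize g k hg M h
    rw [mul_pow, Real.sq_sqrt (by norm_num)]
    nlinarith [Real.cos_sq_le_one θ]
  have hb := bern_trig P _ (3 * k) hPd M hbd s t
  rw [hs, ht, hPe, hPe] at hb
  have hle : ((3 * k : ℕ) : ℝ) * |t - s| ≤ e := by
    push_cast
    refine le_trans ?_ he
    gcongr
  have h0 : 0 ≤ ((3 * k : ℕ) : ℝ) * |t - s| := by positivity
  refine ⟨hb.1.trans (by gcongr), fun hm => (hb.2 hm).trans (by gcongr)⟩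

open Polynomial in
lemma core (n : ℕ) (k : ℕ) (Φ : (Fin (n+1) → ℝ) → ℝ)
    (hΦ : ∀ (u : Fin (n+1) → ℝ) (i : Fin (n+1)), ∃ g : ℝ[X], g.natDegree ≤ k ∧
      ∀ t, Φ (Function.update u i t) = g.eval t * (9/5 - t^2)^k)
    (M : ℝ) (hM : ∀ u, (∀ i, |u i| ≤ 1) → |Φ u| ≤ M)
    (c y : Fin (n+1) → ℝ) (hc : ∀ i, |c i| ≤ 1) (hy : ∀ i, |y i| ≤ 1) (hcM : |Φ c| = M)
    (e : ℝ) (he : ∀ i, 3 * k * (1.12 * |y i - c i|) ≤ e) :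
    |Φ y - Φ c| ≤ (e ^ 2 + n * e) * M := by
  have hslice : ∀ (u : Fin (n+1) → ℝ) (i : Fin (n+1)), (∀ j, |u j| ≤ 1) → u i = c i →
      |Φ (Function.update u i (y i)) - Φ u| ≤ e * M ∧
      (|Φ u| = M → |Φ (Function.update u i (y i)) - Φ u| ≤ e^2 * M) := by
    intro u i hu hui
    obtain ⟨g, hg, hgt⟩ := hΦ u i
    have hx := hgt (u i)
    rw [Function.update_eq_self] at hx
    rw [hgt, hx]
    refine step_bound g k hg M ?_ (u i) (y i) (hu i) (hy i) e (by rw [hui]; exact he i)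
    intro t ht
    rw [← hgt]
    apply hM
    intro j
    rcases eq_or_ne j i with rfl | hj
    · simpa using ht
    · rw [Function.update_of_ne hj]; exact hu j
  -- first step along coordinate 0, then the others
  have key : ∀ s : Finset (Fin (n+1)), (0 : Fin (n+1)) ∉ s →
      |Φ (fun i => if i = 0 ∨ i ∈ s then y i else c i) - Φ c| ≤ (e^2 + s.card * e) * M := by
    intro s
    induction s using Finset.induction with
    | empty =>
      intro _
      have := (hslice c 0 hc rfl).2 hcM
      have e1 : Function.update c 0 (y 0) = (fun i => if i = 0 ∨ i ∈ (∅ : Finset (Fin (n+1))) then y i else c i) := by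
        funext i
        rcases eq_or_ne i 0 with rfl | hi
        · simp
        · simp [hi]
      rw [e1] at this
      simpa using this
    | insert a s ha ih =>
      intro h0
      have ha0 : a ≠ 0 := by rintro rfl; exact h0 (Finset.mem_insert_self _ _)
      have ih' := ih (fun hh => h0 (Finset.mem_insert_of_mem hh))
      set u : Fin (n+1) → ℝ := fun i => if i = 0 ∨ i ∈ s then y i else c i with hu
      have hstep := (hslice u a (by intro j; simp only [hu]; split_ifs; exacts [hy j, hc j]) (by simp [hu, ha0, ha])).1
      have e1 : Function.update u a (y a) = (fun i => if i = 0 ∨ i ∈ insert a s then y i else c i) := by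
        funext i
        rcases eq_or_ne i a with rfl | hi
        · simp
        · simp [hi, hu]
      rw [e1] at hstep
      rw [Finset.card_insert_of_notMem ha]
      push_cast
      have := abs_sub_le (Φ (fun i => if i = 0 ∨ i ∈ insert a s then y i else c i)) (Φ u) (Φ c)
      linarith
  have hfin := key (Finset.univ.erase 0) (by simp)
  have e1 : (fun i => if i = 0 ∨ i ∈ Finset.univ.erase (0 : Fin (n+1)) then y i else c i) = y := by
    funext i
    rcases eq_or_ne i 0 with rfl | hi
    · simp
    · simp [hi]
  rw [e1] at hfin
  simpa using hfin

lemma cell_exists (q : ℕ) (hq : 0 < q) (v : ℝ) (h0 : 0 ≤ v) (h1 : v ≤ 1) :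
    ∃ j : Fin q, (j : ℝ) ≤ v * q ∧ v * q ≤ j + 1 := by
  have hq' : (0:ℝ) < q := by exact_mod_cast hq
  rcases lt_or_eq_of_le h1 with h | h
  · have hv : 0 ≤ v * q := by positivity
    refine ⟨⟨⌊v * q⌋₊, ?_⟩, ?_, ?_⟩
    · rw [Nat.floor_lt hv]; nlinarith
    · exact Nat.floor_le hv
    · exact (Nat.lt_floor_add_one _).le
  · refine ⟨⟨q - 1, by omega⟩, ?_, ?_⟩
    · simp only [h]; rw [Nat.cast_sub hq]; push_cast; linarith
    · simp only [h]; rw [Nat.cast_sub hq]; push_cast; linarith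

lemma prod_diff (i k : ℕ) (hik : i ≤ k) :
    ∏ j ∈ Finset.range (k+1), (if j = i then (1:ℝ) else |(i:ℝ) - j|)
      = (i.factorial : ℝ) * ((k - i).factorial : ℝ) := by
  induction k, hik using Nat.le_induction with
  | base =>
    rw [Finset.prod_range_succ, if_pos rfl, Nat.sub_self, Nat.factorial_zero, mul_one, Nat.cast_one, mul_one,
      ← Finset.prod_range_reflect, ← Finset.prod_range_add_one_eq_factorial]
    push_cast
    refine Finset.prod_congr rfl ?_
    intro j hj
    have hj' : j < i := Finset.mem_range.mp hj
    rw [if_neg (by omega), show i - 1 - j = i - (j + 1) by omega, Nat.cast_sub (by omega)]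
    push_cast
    rw [abs_of_nonneg (by ring_nf; positivity)]; ring
  | succ k hk ih =>
    rw [Finset.prod_range_succ, ih, if_neg (by omega), show k + 1 - i = (k - i) + 1 by omega,
      Nat.factorial_succ]
    have : (i:ℝ) ≤ k := by exact_mod_cast hk
    rw [abs_of_nonpos (by push_cast; linarith)]
    push_cast
    rw [Nat.cast_sub hk]; ring

open Polynomial in
lemma one_dim (g : ℝ[X]) (k : ℕ) (hg : g.natDegree ≤ k) (B b z M : ℝ) (hb : 0 < b) (v : ℕ → ℝ)
    (hv : ∀ i, i ≤ k → z ≤ v i ∧ v i ≤ z + b) (hM : ∀ i, i ≤ k → |g.eval (v i)| ≤ M)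
    (hB : 0 < B)
    (hsep : ∀ i j, i < j → j ≤ k → ((j:ℝ) - i) * (b / B) ≤ v j - v i)
    (x : ℝ) (hx : z ≤ x ∧ x ≤ z + b) :
    |g.eval x| ≤ (2 * B) ^ k / k.factorial * M := by
  have hM0 : 0 ≤ M := (abs_nonneg _).trans (hM 0 (Nat.zero_le _))
  have hsep' : ∀ i j, i ≤ k → j ≤ k → |(i:ℝ) - j| * (b / B) ≤ |v i - v j| := by
    intro i j hi hj
    rcases lt_trichotomy i j with h | h | h
    · have := hsep i j h hj
      have hc : (i:ℝ) < j := by exact_mod_cast h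
      rw [abs_sub_comm, abs_of_pos (by linarith), abs_sub_comm]
      exact this.trans (le_abs_self _)
    · subst h; simp
    · have := hsep j i h hi
      have hc : (j:ℝ) < i := by exact_mod_cast h
      rw [abs_of_pos (by linarith)]
      exact this.trans (le_abs_self _)
  have hpos : ∀ i j, i ≤ k → j ≤ k → i ≠ j → 0 < |(i:ℝ) - j| := by
    intro i j _ _ hij
    rw [abs_pos, sub_ne_zero]; exact_mod_cast hij
  have hinj : Set.InjOn v (Finset.range (k+1) : Finset ℕ) := by
    intro i hi j hj hij
    by_contra hne
    have hi' : i ≤ k := by simpa [Nat.lt_succ_iff] using hi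
    have hj' : j ≤ k := by simpa [Nat.lt_succ_iff] using hj
    have h1 := hsep' i j hi' hj'
    have h2 := hpos i j hi' hj' hne
    rw [hij, sub_self, abs_zero] at h1
    have : 0 < |(i:ℝ) - j| * (b / B) := by positivity
    linarith
  have hdeg : g.degree < (Finset.range (k+1)).card := by
    rw [Finset.card_range]
    exact lt_of_le_of_lt degree_le_natDegree (by exact_mod_cast Nat.lt_succ_of_le hg)
  have hint := Lagrange.eq_interpolate hinj hdeg
  rw [hint, Lagrange.interpolate_apply, eval_finsetSum]
  have hterm : ∀ i ∈ Finset.range (k+1),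
      |eval x (C (eval (v i) g) * Lagrange.basis (Finset.range (k+1)) v i)|
        ≤ M * (B ^ k / (i.factorial * (k-i).factorial)) := by
    intro i hi
    have hi' : i ≤ k := by simpa [Nat.lt_succ_iff] using hi
    rw [eval_mul, eval_C, abs_mul]
    refine mul_le_mul (hM i hi') ?_ (abs_nonneg _) hM0
    rw [Lagrange.basis, eval_prod, Finset.abs_prod]
    have e1 : B ^ k / ((i.factorial : ℝ) * (k-i).factorial)
        = ∏ j ∈ (Finset.range (k+1)).erase i, (B / |(i:ℝ) - j|) := by
      rw [Finset.prod_div_distrib, Finset.prod_const, Finset.card_erase_of_mem hi, Finset.card_range,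
        Nat.add_sub_cancel, ← prod_diff i k hi', ← Finset.mul_prod_erase _ _ hi, if_pos rfl, one_mul]
      congr 1
      refine Finset.prod_congr rfl ?_
      intro j hj
      rw [if_neg (Finset.ne_of_mem_erase hj)]
    rw [e1]
    refine Finset.prod_le_prod (fun _ _ => abs_nonneg _) ?_
    intro j hj
    have hj' : j ≤ k := by
      have := Finset.mem_of_mem_erase hj
      simpa [Nat.lt_succ_iff] using this
    have hp := hpos i j hi' hj' (Finset.ne_of_mem_erase hj).symm
    have hs := hsep' i j hi' hj'
    have hp2 : 0 < |v i - v j| := lt_of_lt_of_le (by positivity) hs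
    simp only [Lagrange.basisDivisor, eval_mul, eval_C, eval_sub, eval_X]
    rw [abs_mul, abs_inv, inv_mul_eq_div, div_le_div_iff₀ hp2 hp]
    have hxv : |x - v j| ≤ b := by
      have := hv j hj'
      rw [abs_le]; constructor <;> linarith [hx.1, hx.2, this.1, this.2]
    calc |x - v j| * |(i:ℝ) - j| ≤ b * |(i:ℝ) - j| := by gcongr
      _ = B * (|(i:ℝ) - j| * (b / B)) := by field_simp
      _ ≤ B * |v i - v j| := by gcongr
  refine (Finset.abs_sum_le_sum_abs _ _).trans ((Finset.sum_le_sum hterm).trans (le_of_eq ?_))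
  have h2 : ∑ i ∈ Finset.range (k+1), ((k.choose i : ℕ) : ℝ) = 2 ^ k := by
    exact_mod_cast Nat.sum_range_choose k
  rw [← Finset.mul_sum, mul_pow, ← h2, Finset.sum_mul, Finset.sum_div, mul_comm]
  congr 1
  refine Finset.sum_congr rfl ?_
  intro i hi
  have hi' : i ≤ k := by simpa [Nat.lt_succ_iff] using hi
  have hc : ((k.choose i : ℕ) : ℝ) * i.factorial * (k-i).factorial = k.factorial := by
    exact_mod_cast Nat.choose_mul_factorial_mul_factorial hi'
  have f1 : (i.factorial : ℝ) ≠ 0 := by exact_mod_cast i.factorial_ne_zero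
  have f2 : ((k-i).factorial : ℝ) ≠ 0 := by exact_mod_cast (k-i).factorial_ne_zero
  have f3 : (k.factorial : ℝ) ≠ 0 := by exact_mod_cast k.factorial_ne_zero
  rw [div_eq_div_iff (mul_ne_zero f1 f2) f3, ← hc]; ring

lemma gamma_ge (N : ℕ) : 12 ≤ gammaMN (N + 2) := by
  induction N with
  | zero => simp [gammaMN]; norm_num
  | succ N ih =>
    rw [show N + 1 + 2 = (N + 1) + 2 from rfl, gammaMN]
    push_cast
    have : (0:ℝ) ≤ N := Nat.cast_nonneg N
    rw [show N + 1 + 1 = N + 2 from rfl]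
    nlinarith

lemma gamma_loss (N : ℕ) : (6.72 / gammaMN (N + 2)) ^ 2 + ((N + 1 : ℕ) : ℝ) * (6.72 / gammaMN (N + 2)) ≤ 7 / 8 := by
  cases N with
  | zero => simp [gammaMN]; norm_num
  | succ N =>
    have h := gamma_ge N
    have hg : gammaMN (N + 1 + 2) = 2 * ((N:ℝ) + 3) * (1 + gammaMN (N + 2)) := by
      rw [gammaMN]; push_cast; ring
    have hN : (0:ℝ) ≤ N := Nat.cast_nonneg N
    have h2 : 26 * ((N:ℝ) + 3) ≤ gammaMN (N + 1 + 2) := by rw [hg]; nlinarith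
    set γ := gammaMN (N + 1 + 2)
    have hγ : 0 < γ := by linarith
    have h3 : 6.72 / γ ≤ 0.26 / (N + 3) := by
      rw [div_le_div_iff₀ hγ (by linarith)]; nlinarith
    have h4 : 0.26 / ((N:ℝ) + 3) ≤ 0.1 := by
      rw [div_le_iff₀ (by linarith)]; linarith
    have h5 : ((N:ℝ) + 3) * (0.26 / (N + 3)) = 0.26 := by field_simp
    have h0 : 0 ≤ 6.72 / γ := by positivity
    push_cast
    nlinarith

lemma slice_poly {n : ℕ} (p : MvPolynomial (Fin n) ℝ) (k : ℕ) (hp : p.totalDegree ≤ k)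
    (f : Fin n → Polynomial ℝ) (hf : ∀ i, (f i).natDegree ≤ 1) :
    ∃ g : Polynomial ℝ, g.natDegree ≤ k ∧
      ∀ t, g.eval t = MvPolynomial.eval (fun i => (f i).eval t) p := by
  refine ⟨MvPolynomial.aeval f p, ?_, ?_⟩
  · simpa using MvPolynomial.aeval_natDegree_le (m := k) (n := 1) p hp f hf
  · intro t
    rw [MvPolynomial.aeval_def, MvPolynomial.eval₂_eq', MvPolynomial.eval_eq', Polynomial.eval_finsetSum]
    simp [Polynomial.eval_prod]

lemma case_one (k : ℕ) (q : ℕ)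
    (hq : gammaMN 1 * (k + 1) ≤ (q : ℝ))
    (z : Fin 1 → ℝ) (b : ℝ) (hb : 0 < b)
    (y : (Fin 1 → Fin q) → (Fin 1 → ℝ))
    (hy : ∀ j : Fin 1 → Fin q, ∀ i : Fin 1,
      z i + (j i : ℝ) * (b / q) ≤ y j i ∧ y j i ≤ z i + ((j i : ℝ) + 1) * (b / q))
    (p : MvPolynomial (Fin 1) ℝ) (hp : p.totalDegree ≤ k) :
    ∀ x : Fin 1 → ℝ, (∀ i, z i ≤ x i ∧ x i ≤ z i + b) →
      |MvPolynomial.eval x p| ≤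
        Real.exp (2 * (1:ℕ) * gammaMN 1 * (k + 1)) *
          ⨆ j : Fin 1 → Fin q, |MvPolynomial.eval (y j) p| := by
  intro x hx
  have hγ : gammaMN 1 = 2 := by simp [gammaMN]
  rw [hγ] at hq ⊢
  have hq2 : 2 * (k + 1) ≤ q := by exact_mod_cast hq
  have hq0 : 0 < q := by omega
  have hq0' : (0:ℝ) < q := by exact_mod_cast hq0
  set s := q / (k + 1) with hs
  have hs2 : 2 ≤ s := by rw [hs, Nat.le_div_iff_mul_le (by omega)]; exact hq2
  have hsq : s * (k + 1) ≤ q := Nat.div_mul_le_self q (k+1)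
  have hsq' : q < (s + 1) * (k + 1) := Nat.lt_mul_of_div_lt (Nat.lt_succ_self _) (by omega)
  obtain ⟨g, hg, hge⟩ := slice_poly p k hp (fun _ => Polynomial.X) (fun _ => Polynomial.natDegree_X_le)
  have hconst : ∀ u : Fin 1 → ℝ, (fun _ : Fin 1 => u 0) = u := by
    intro u; funext i; rw [Subsingleton.elim i 0]
  have hge' : ∀ u : Fin 1 → ℝ, g.eval (u 0) = MvPolynomial.eval u p := by
    intro u; rw [hge]; simp only [Polynomial.eval_X]; rw [hconst]
  set S := ⨆ j : Fin 1 → Fin q, |MvPolynomial.eval (y j) p| with hS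
  have hSle : ∀ j, |MvPolynomial.eval (y j) p| ≤ S := fun j =>
    le_ciSup (f := fun j => |MvPolynomial.eval (y j) p|) (Set.finite_range _).bddAbove j
  have hidx : ∀ i, i ≤ k → i * s < q := by
    intro i hi
    have : i * s ≤ k * s := Nat.mul_le_mul_right s hi
    nlinarith
  let v : ℕ → ℝ := fun i => y (fun _ => ⟨(i * s) % q, Nat.mod_lt _ hq0⟩) 0
  have hvb : ∀ i, i ≤ k → z 0 + ((i:ℝ) * s) * (b / q) ≤ v i ∧ v i ≤ z 0 + ((i:ℝ) * s + 1) * (b / q) := by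
    intro i hi
    have := hy (fun _ => ⟨(i * s) % q, Nat.mod_lt _ hq0⟩) 0
    simp only [Nat.mod_eq_of_lt (hidx i hi)] at this
    push_cast at this
    simpa only [v, Nat.mod_eq_of_lt (hidx i hi)] using this
  have hmain := one_dim g k hg (3 * (k + 1)) b (z 0) S hb v ?_ ?_ (by positivity) ?_ (x 0) (hx 0)
  · rw [hge'] at hmain
    refine hmain.trans ?_
    have hS0 : 0 ≤ S := (abs_nonneg _).trans (hSle (fun _ => ⟨0, hq0⟩))
    refine mul_le_mul_of_nonneg_right ?_ hS0
    have h1 : ((k:ℝ) + 1) ^ k / k.factorial ≤ Real.exp (k + 1) :=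
      Real.pow_div_factorial_le_exp _ (by positivity) k
    have h6 : (6:ℝ) ≤ Real.exp 2 := by
      have : Real.exp 2 = Real.exp 1 * Real.exp 1 := by rw [← Real.exp_add]; norm_num
      rw [this]; nlinarith [Real.exp_one_gt_d9]
    calc (2 * (3 * ((k:ℝ) + 1))) ^ k / k.factorial = 6 ^ k * (((k:ℝ) + 1) ^ k / k.factorial) := by
          rw [show 2 * (3 * ((k:ℝ) + 1)) = 6 * (k + 1) by ring, mul_pow]; ring
      _ ≤ (Real.exp 2) ^ k * Real.exp (k + 1) := by gcongr
      _ = Real.exp (k * 2 + (k + 1)) := by rw [← Real.exp_nat_mul, ← Real.exp_add]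
      _ ≤ _ := by
          apply Real.exp_le_exp.mpr
          push_cast
          have : (0:ℝ) ≤ k := Nat.cast_nonneg k
          linarith
  · intro i hi
    have h := hvb i hi
    have hlt : (i:ℝ) * s + 1 ≤ q := by exact_mod_cast hidx i hi
    constructor
    · have : 0 ≤ ((i:ℝ) * s) * (b / q) := by positivity
      linarith
    · have : ((i:ℝ) * s + 1) * (b / q) ≤ q * (b / q) := by gcongr
      have e : (q:ℝ) * (b / q) = b := by field_simp
      linarith
  · intro i hi
    rw [hge' (y (fun _ => ⟨(i * s) % q, Nat.mod_lt _ hq0⟩))]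
    exact hSle _
  · intro i j hij hj
    have h1 := (hvb i (by omega)).2
    have h2 := (hvb j hj).1
    have hd : (1:ℝ) ≤ (j:ℝ) - i := by
      have : (i:ℝ) + 1 ≤ j := by exact_mod_cast hij
      linarith
    have hs2' : (2:ℝ) ≤ s := by exact_mod_cast hs2
    have hsq2 : (q:ℝ) ≤ (s + 1) * (k + 1) := by exact_mod_cast hsq'.le
    have h3 : (((j:ℝ) - i) * s - 1) * (b / q) ≤ v j - v i := by linarith
    refine le_trans ?_ h3
    set d := (j:ℝ) - i
    have hk : (0:ℝ) < (k:ℝ) + 1 := by positivity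
    rw [← mul_div_assoc, ← mul_div_assoc, div_le_div_iff₀ (by positivity) hq0']
    have h4 : d * q ≤ (d * s - 1) * (3 * (k + 1)) := by
      have h5 : d * q ≤ d * ((s + 1) * (k + 1)) := by gcongr
      have h6 : d * (s + 1) ≤ 3 * (d * s - 1) := by nlinarith
      have h7 := mul_le_mul_of_nonneg_right h6 hk.le
      linarith
    have := mul_le_mul_of_nonneg_right h4 hb.le
    linarith

lemma case_ge_two (N : ℕ) (k : ℕ) (q : ℕ)
    (hq : gammaMN (N + 2) * (k + 1) ≤ (q : ℝ))
    (z : Fin (N + 2) → ℝ) (b : ℝ) (hb : 0 < b)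
    (y : (Fin (N + 2) → Fin q) → (Fin (N + 2) → ℝ))
    (hy : ∀ j : Fin (N + 2) → Fin q, ∀ i : Fin (N + 2),
      z i + (j i : ℝ) * (b / q) ≤ y j i ∧ y j i ≤ z i + ((j i : ℝ) + 1) * (b / q))
    (p : MvPolynomial (Fin (N + 2)) ℝ) (hp : p.totalDegree ≤ k) :
    ∀ x : Fin (N + 2) → ℝ, (∀ i, z i ≤ x i ∧ x i ≤ z i + b) →
      |MvPolynomial.eval x p| ≤
        Real.exp (2 * (N + 2 : ℕ) * gammaMN (N + 2) * (k + 1)) *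
          ⨆ j : Fin (N + 2) → Fin q, |MvPolynomial.eval (y j) p| := by
  intro x hx
  have hγ := gamma_ge N
  have hloss := gamma_loss N
  set γ := gammaMN (N + 2) with hγd
  have hk0 : (0:ℝ) ≤ k := Nat.cast_nonneg k
  have hq0' : (0:ℝ) < q := by nlinarith
  have hq0 : 0 < q := by exact_mod_cast hq0'
  set A : (Fin (N + 2) → ℝ) → (Fin (N + 2) → ℝ) := fun u i => z i + b / 2 * (u i + 1) with hA
  set F : (Fin (N + 2) → ℝ) → ℝ := fun u => MvPolynomial.eval (A u) p with hF
  set W : (Fin (N + 2) → ℝ) → ℝ := fun u => ∏ i, (9/5 - (u i)^2)^k with hW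
  set Φ : (Fin (N + 2) → ℝ) → ℝ := fun u => F u * W u with hΦ
  have hcont : Continuous Φ := by
    have hAc : Continuous A := by fun_prop
    have : Continuous F := (MvPolynomial.continuous_eval p).comp hAc
    have hWc : Continuous W := by fun_prop
    exact this.mul hWc
  have hslice : ∀ (u : Fin (N+2) → ℝ) (i : Fin (N+2)), ∃ g : Polynomial ℝ, g.natDegree ≤ k ∧
      ∀ t, Φ (Function.update u i t) = g.eval t * (9/5 - t^2)^k := by
    intro u i
    obtain ⟨g, hg, hge⟩ := slice_poly p k hp
      (fun j => if j = i then Polynomial.C (b/2) * Polynomial.X + Polynomial.C (z j + b/2)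
        else Polynomial.C (A u j)) (by
          intro j
          split_ifs
          · exact Polynomial.natDegree_linear_le
          · simp)
    refine ⟨g * Polynomial.C (∏ j ∈ Finset.univ.erase i, (9/5 - (u j)^2)^k),
      (Polynomial.natDegree_mul_C_le _ _).trans hg, ?_⟩
    intro t
    have e1 : A (Function.update u i t) = fun j => Polynomial.eval t (if j = i then Polynomial.C (b/2) * Polynomial.X + Polynomial.C (z j + b/2)
        else Polynomial.C (A u j)) := by
      funext j
      rcases eq_or_ne j i with rfl | hj
      · simp [hA]; ring
      · simp [hA, hj]
    have e2 : W (Function.update u i t) = (9/5 - t^2)^k * ∏ j ∈ Finset.univ.erase i, (9/5 - (u j)^2)^k := by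
      simp only [hW]
      rw [← Finset.mul_prod_erase _ _ (Finset.mem_univ i)]
      congr 1
      · simp
      · refine Finset.prod_congr rfl ?_
        intro j hj
        rw [Function.update_of_ne (Finset.ne_of_mem_erase hj)]
    simp only [hΦ, hF]
    rw [e1, e2, Polynomial.eval_mul, Polynomial.eval_C, hge]; ring
  obtain ⟨c, hcmem, hcmax⟩ := (isCompact_Icc (a := fun _ : Fin (N+2) => (-1:ℝ)) (b := fun _ => (1:ℝ))).exists_isMaxOn
    ⟨fun _ => 0, by constructor <;> intro i <;> norm_num⟩ (hcont.abs.continuousOn)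
  have hc : ∀ i, |c i| ≤ 1 := fun i => abs_le.mpr ⟨hcmem.1 i, hcmem.2 i⟩
  have hmax : ∀ u, (∀ i, |u i| ≤ 1) → |Φ u| ≤ |Φ c| := by
    intro u hu
    exact hcmax (show u ∈ Set.Icc _ _ from ⟨fun i => (abs_le.mp (hu i)).1, fun i => (abs_le.mp (hu i)).2⟩)
  have hcell : ∀ i, ∃ j : Fin q, (j : ℝ) ≤ (c i + 1) / 2 * q ∧ (c i + 1) / 2 * q ≤ j + 1 := by
    intro i
    have := abs_le.mp (hc i)
    exact cell_exists q hq0 _ (by linarith) (by linarith)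
  choose j hj1 hj2 using hcell
  set Y : Fin (N+2) → ℝ := fun i => (y j i - z i) * 2 / b - 1 with hY
  have hAY : A Y = y j := by
    funext i; simp only [hA, hY]; field_simp; ring
  have hYb : ∀ i, 2 * (j i : ℝ) / q ≤ Y i + 1 ∧ Y i + 1 ≤ 2 * ((j i : ℝ) + 1) / q := by
    intro i
    have h := hy j i
    simp only [hY]
    rw [sub_add_cancel]
    constructor
    · rw [le_div_iff₀ hb]
      have : 2 * (j i : ℝ) / q * b = 2 * ((j i : ℝ) * (b / q)) := by ring
      linarith [h.1]
    · rw [div_le_iff₀ hb]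
      have : 2 * ((j i : ℝ) + 1) / q * b = 2 * (((j i : ℝ) + 1) * (b / q)) := by ring
      linarith [h.2]
  have hY1 : ∀ i, |Y i| ≤ 1 := by
    intro i
    have h := hYb i
    have h1 : 0 ≤ 2 * (j i : ℝ) / q := by positivity
    have h2 : 2 * ((j i : ℝ) + 1) / q ≤ 2 := by
      rw [div_le_iff₀ hq0']
      have : (j i : ℝ) + 1 ≤ q := by exact_mod_cast (j i).isLt
      linarith
    rw [abs_le]; constructor <;> linarith [h.1, h.2]
  have hYc : ∀ i, |Y i - c i| ≤ 2 / q := by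
    intro i
    have h := hYb i
    have h1 : 2 * (j i : ℝ) / q ≤ c i + 1 := by
      rw [div_le_iff₀ hq0']; linarith [hj1 i]
    have h2 : c i + 1 ≤ 2 * ((j i : ℝ) + 1) / q := by
      rw [le_div_iff₀ hq0']; linarith [hj2 i]
    have h3 : 2 * ((j i : ℝ) + 1) / q = 2 * (j i : ℝ) / q + 2 / q := by ring
    rw [abs_le]; constructor <;> linarith [h.1, h.2]
  have he : ∀ i, 3 * (k:ℝ) * (1.12 * |Y i - c i|) ≤ 6.72 / γ := by
    intro i
    calc 3 * (k:ℝ) * (1.12 * |Y i - c i|) ≤ 3 * (k:ℝ) * (1.12 * (2 / q)) := by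
          gcongr; exact hYc i
      _ = 6.72 * k / q := by ring
      _ ≤ 6.72 / γ := by
          rw [div_le_div_iff₀ hq0' (by linarith)]
          nlinarith
  have hcore := core (N + 1) k Φ hslice |Φ c| hmax c Y hc hY1 rfl _ he
  have hΦY : |Φ c| ≤ 8 * |Φ Y| := by
    have h1 := mul_le_mul_of_nonneg_right hloss (abs_nonneg (Φ c))
    have h2 := abs_sub_abs_le_abs_sub (Φ c) (Φ Y)
    rw [abs_sub_comm] at h2
    linarith
  have hWup : ∀ u : Fin (N+2) → ℝ, (∀ i, |u i| ≤ 1) →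
      ((4/5 : ℝ)^k)^(N+2) ≤ W u ∧ W u ≤ ((9/5 : ℝ)^k)^(N+2) := by
    intro u hu
    have hsq : ∀ i, (u i)^2 ≤ 1 := fun i => by
      rw [← sq_abs]; nlinarith [abs_nonneg (u i), hu i]
    constructor
    · have := Finset.prod_le_prod (s := (Finset.univ : Finset (Fin (N+2)))) (f := fun _ => (4/5 : ℝ)^k)
        (g := fun i => (9/5 - (u i)^2)^k) (fun _ _ => by positivity)
        (fun i _ => by gcongr; linarith [hsq i])
      simpa using this
    · have := Finset.prod_le_prod (s := (Finset.univ : Finset (Fin (N+2)))) (g := fun _ => (9/5 : ℝ)^k)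
        (f := fun i => (9/5 - (u i)^2)^k) (fun i _ => pow_nonneg (by linarith [hsq i]) k)
        (fun i _ => by
          have := hsq i
          exact pow_le_pow_left₀ (by linarith) (by linarith [sq_nonneg (u i)]) k)
      simpa using this
  set U : Fin (N+2) → ℝ := fun i => (x i - z i) * 2 / b - 1 with hU
  have hAU : A U = x := by
    funext i; simp only [hA, hU]; field_simp; ring
  have hU1 : ∀ i, |U i| ≤ 1 := by
    intro i
    have h := hx i
    have h1 : 0 ≤ (x i - z i) * 2 / b := div_nonneg (by linarith [h.1]) hb.le
    have h2 : (x i - z i) * 2 / b ≤ 2 := by rw [div_le_iff₀ hb]; linarith [h.2]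
    simp only [hU]
    rw [abs_le]; constructor <;> linarith
  have hFU : F U = MvPolynomial.eval x p := by simp only [hF]; rw [hAU]
  have hFY : F Y = MvPolynomial.eval (y j) p := by simp only [hF]; rw [hAY]
  set S := ⨆ j : Fin (N + 2) → Fin q, |MvPolynomial.eval (y j) p| with hS
  have hSle : |F Y| ≤ S := by
    rw [hFY]
    exact le_ciSup (f := fun j => |MvPolynomial.eval (y j) p|) (Set.finite_range _).bddAbove j
  have hS0 : 0 ≤ S := (abs_nonneg _).trans hSle
  set a : ℝ := ((4/5 : ℝ)^k)^(N+2) with ha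
  have ha0 : 0 < a := by positivity
  have h1 : |F U| * a ≤ 8 * (S * ((9/5 : ℝ)^k)^(N+2)) := by
    have hWU := hWup U hU1
    have hWY := hWup Y hY1
    calc |F U| * a ≤ |F U| * W U := by gcongr; exact hWU.1
      _ = |Φ U| := by simp only [hΦ]; rw [abs_mul, abs_of_nonneg (ha0.le.trans hWU.1)]
      _ ≤ |Φ c| := hmax U hU1
      _ ≤ 8 * |Φ Y| := hΦY
      _ = 8 * (|F Y| * W Y) := by simp only [hΦ]; rw [abs_mul, abs_of_nonneg (ha0.le.trans hWY.1)]
      _ ≤ _ := by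
        have := mul_le_mul hSle hWY.2 (ha0.le.trans hWY.1) hS0
        linarith
  have h2 : ((9/5 : ℝ)^k)^(N+2) = ((9/4 : ℝ)^k)^(N+2) * a := by
    rw [ha, ← mul_pow, ← mul_pow]; norm_num
  have h3 : |F U| ≤ 8 * ((9/4 : ℝ)^k)^(N+2) * S := by
    rw [h2] at h1
    refine le_of_mul_le_mul_right (h1.trans (le_of_eq ?_)) ha0
    ring
  rw [← hFU]
  refine h3.trans (mul_le_mul_of_nonneg_right ?_ hS0)
  have e1 : (9/4 : ℝ) ≤ Real.exp 1 := by linarith [Real.exp_one_gt_d9]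
  have e8 : (8 : ℝ) ≤ Real.exp 3 := by
    have : Real.exp 3 = Real.exp 1 ^ 3 := by rw [← Real.exp_nat_mul]; norm_num
    rw [this]
    calc (8:ℝ) = 2 ^ 3 := by norm_num
      _ ≤ _ := by gcongr; linarith
  calc 8 * ((9/4 : ℝ)^k)^(N+2) ≤ Real.exp 3 * (Real.exp 1 ^ k)^(N+2) := by gcongr
    _ = Real.exp (3 + ((N + 2 : ℕ) : ℝ) * (k * 1)) := by
        rw [← Real.exp_nat_mul, ← Real.exp_nat_mul, ← Real.exp_add]
    _ ≤ _ := by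
        apply Real.exp_le_exp.mpr
        push_cast
        have hN : (0:ℝ) ≤ N := Nat.cast_nonneg N
        have : 12 * (((N:ℝ) + 2) * (k + 1)) ≤ γ * (((N:ℝ) + 2) * (k + 1)) := by gcongr
        nlinarith [mul_nonneg hN hk0]

theorem polynomial_sup_bound (n : ℕ) (hn : 1 ≤ n) (k : ℕ) (q : ℕ)
    (hq : gammaMN n * (k + 1) ≤ (q : ℝ))
    (z : Fin n → ℝ) (b : ℝ) (hb : 0 < b)
    (y : (Fin n → Fin q) → (Fin n → ℝ))
    (hy : ∀ j : Fin n → Fin q, ∀ i : Fin n,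
      z i + (j i : ℝ) * (b / q) ≤ y j i ∧ y j i ≤ z i + ((j i : ℝ) + 1) * (b / q))
    (p : MvPolynomial (Fin n) ℝ) (hp : p.totalDegree ≤ k) :
    ∀ x : Fin n → ℝ, (∀ i, z i ≤ x i ∧ x i ≤ z i + b) →
      |MvPolynomial.eval x p| ≤
        Real.exp (2 * n * gammaMN n * (k + 1)) *
          ⨆ j : Fin n → Fin q, |MvPolynomial.eval (y j) p| := by
  match n, hn with
  | 1, _ => exact case_one k q hq z b hb y hy p hp
  | N + 2, _ => exact case_ge_two N k q hq z b hb y hy p hp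
end

section
/- Let n ≥ 1 and define γ_1 = 2 and γ_n = 2n(1 + γ_{n-1}) for n > 1. Let Q be a cube in ℝ^n of side length b > 0 subdivided into q^n identical closed subcubes of side b/q, with q ≥ γ_n(k+1), and let y_j be a point selected from the subcube indexed by j ∈ {0,…,q−1}^n. Then for every point x ∈ Q there exist real weights (w_j)_{j ∈ {0,…,q−1}^n} such that Σ_j w_j · p(y_j) = p(x) for every polynomial p in n variables of total degree at most k, and Σ_j |w_j| ≤ e^{2nγ_n(k+1)}. (Equivalently: there is a signed measure σ supported on Y = {y_j} with ∫ p dσ = p(x) for all such p and total variation ∫ d|σ| ≤ e^{2nγ_n(k+1)}.) -/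
section helpers
open Real
lemma weights_of_norming {J V : Type*} [Fintype J] [AddCommGroup V] [Module ℝ V]
    (T : V →ₗ[ℝ] (J → ℝ)) (e : V →ₗ[ℝ] ℝ) (C : ℝ) (hC : 0 ≤ C)
    (h : ∀ v, |e v| ≤ C * ‖T v‖) :
    ∃ w : J → ℝ, (∀ v, ∑ j, w j * T v j = e v) ∧ ∑ j, |w j| ≤ C := by
  classical
  have hker : LinearMap.ker T ≤ LinearMap.ker e := by
    intro v hv
    have hv' : T v = 0 := hv
    have := h v
    rw [hv', norm_zero, mul_zero] at this
    exact abs_nonpos_iff.mp this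
  obtain ⟨φ, hφ⟩ : ∃ φ : LinearMap.range T →ₗ[ℝ] ℝ, ∀ v, φ ⟨T v, v, rfl⟩ = e v := by
    refine ⟨((LinearMap.ker T).liftQ e hker).comp T.quotKerEquivRange.symm.toLinearMap, ?_⟩
    intro v
    have : T.quotKerEquivRange.symm ⟨T v, v, rfl⟩ = (LinearMap.ker T).mkQ v :=
      LinearMap.quotKerEquivRange_symm_apply_image T v _
    simp [this]
  have hφC : ∀ x : LinearMap.range T, ‖φ x‖ ≤ C * ‖x‖ := by
    rintro ⟨_, v, rfl⟩
    rw [hφ]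
    exact h v
  obtain ⟨g, hg, hgn⟩ := exists_extension_norm_eq (LinearMap.range T) (φ.mkContinuous C hφC)
  have hgC : ‖g‖ ≤ C := by
    rw [hgn]; exact LinearMap.mkContinuous_norm_le _ hC _
  have hsum : ∀ u : J → ℝ, ∑ j, g (Pi.single j 1) * u j = g u := by
    intro u
    conv_rhs => rw [← Finset.univ_sum_single u, map_sum]
    refine Finset.sum_congr rfl fun j _ => ?_
    have : Pi.single j (u j) = (u j) • (Pi.single j 1 : J → ℝ) := by
      rw [← Pi.single_smul]; simp
    rw [this, map_smul, smul_eq_mul, mul_comm]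
  refine ⟨fun j => g (Pi.single j 1), fun v => ?_, ?_⟩
  · rw [hsum, ← hφ v]
    exact hg ⟨T v, v, rfl⟩
  · set s : J → ℝ := fun j => SignType.sign (g (Pi.single j 1)) with hs
    have h1 : ∑ j, |g (Pi.single j 1)| = g s := by
      rw [← hsum]
      refine Finset.sum_congr rfl fun j _ => ?_
      simp only [hs]
      rw [self_mul_sign]
    have h2 : ‖s‖ ≤ 1 := by
      rw [pi_norm_le_iff_of_nonneg zero_le_one]
      intro j
      simp only [hs]
      rcases lt_trichotomy (g (Pi.single j 1)) 0 with h | h | h <;> simp [h]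
    calc _ = g s := h1
      _ ≤ ‖g s‖ := le_abs_self _
      _ ≤ ‖g‖ * ‖s‖ := g.le_opNorm _
      _ ≤ C * 1 := by gcongr
      _ = C := mul_one _

/-- the univariate lemma -/
lemma uni_disk (k : ℕ) (p : Polynomial ℝ) (hp : p.natDegree ≤ k) (M : ℝ)
    (h : ∀ t : ℝ, |t| ≤ √3 / 2 → |p.eval t| * (√(1 - t ^ 2)) ^ k ≤ M)
    (u : ℝ) (hu0 : u ≠ 0) (hu : |u| ≤ 1) :
    |p.eval (√3 / 4 * (u + u⁻¹))| * (|u| * (3 / 4 * (1 - u ^ 2 / 3))) ^ k ≤ M := by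
  have h3 : √3 ^ 2 = 3 := Real.sq_sqrt (by norm_num)
  let G : ℂ → ℂ := fun w => (∑ j ∈ Finset.range (k + 1), (p.coeff j : ℂ) * w ^ (k - j) *
    ((√3 / 4 : ℝ) * (w ^ 2 + 1)) ^ j) * ((3 / 4) * (1 - w ^ 2 / 3)) ^ k
  have hG : ∀ w : ℂ, w ≠ 0 → G w = (p.map Complex.ofRealHom).eval ((√3 / 4 : ℝ) * (w + w⁻¹)) *
      (w * ((3 / 4) * (1 - w ^ 2 / 3))) ^ k := by
    intro w hw
    simp only [G]
    rw [Polynomial.eval_eq_sum_range' (n := k + 1)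
      (lt_of_le_of_lt (Polynomial.natDegree_map_le) (by omega)), mul_pow w, ← mul_assoc]
    congr 1
    rw [Finset.sum_mul]
    refine Finset.sum_congr rfl fun j hj => ?_
    have hj' : j ≤ k := by simpa [Nat.lt_succ_iff] using hj
    have : w ^ k = w ^ (k - j) * w ^ j := by rw [← pow_add]; congr 1; omega
    rw [this, Polynomial.coeff_map]
    have h2 : ((√3 / 4 : ℝ) : ℂ) * (w ^ 2 + 1) = ((√3 / 4 : ℝ) * (w + w⁻¹)) * w := by
      field_simp
    rw [h2, mul_pow _ w]
    simp only [Complex.ofRealHom_eq_coe]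
    ring
  have hd : Differentiable ℂ G := by
    simp only [G]; fun_prop
  have hb : ∀ w ∈ frontier (Metric.ball (0 : ℂ) 1), ‖G w‖ ≤ M := by
    intro w hw
    rw [frontier_ball _ one_ne_zero, mem_sphere_zero_iff_norm] at hw
    have hw0 : w ≠ 0 := by rintro rfl; simp at hw
    rw [hG w hw0, norm_mul, norm_pow, norm_mul, hw, one_mul]
    have hns : w.re ^ 2 + w.im ^ 2 = 1 := by
      have := Complex.sq_norm w
      rw [hw, Complex.normSq_apply] at this
      nlinarith
    have hinv : w + w⁻¹ = ((2 * w.re : ℝ) : ℂ) := by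
      have : w⁻¹ = (starRingEnd ℂ) w := by
        rw [Complex.inv_def, Complex.normSq_eq_norm_sq, hw]; simp
      rw [this, Complex.add_conj]
    have e1 : ((√3 / 4 : ℝ) : ℂ) * (w + w⁻¹) = ((√3 / 2 * w.re : ℝ) : ℂ) := by
      rw [hinv]; push_cast; ring
    have e2 : ‖(3 / 4 : ℂ) * (1 - w ^ 2 / 3)‖ = √(1 - (√3 / 2 * w.re) ^ 2) := by
      rw [Complex.norm_def]
      congr 1
      rw [Complex.normSq_apply]
      have a1 : ((3 / 4 : ℂ) * (1 - w ^ 2 / 3)).re = 3 / 4 - (w.re ^ 2 - w.im ^ 2) / 4 := by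
        have : (3 / 4 : ℂ) * (1 - w ^ 2 / 3) = ((3 / 4 : ℝ) : ℂ) - ((1 / 4 : ℝ) : ℂ) * (w * w) := by
          push_cast; ring
        rw [this, Complex.sub_re, Complex.re_ofReal_mul, Complex.ofReal_re, Complex.mul_re]; ring
      have a2 : ((3 / 4 : ℂ) * (1 - w ^ 2 / 3)).im = - (w.re * w.im) / 2 := by
        have : (3 / 4 : ℂ) * (1 - w ^ 2 / 3) = ((3 / 4 : ℝ) : ℂ) - ((1 / 4 : ℝ) : ℂ) * (w * w) := by
          push_cast; ring
        rw [this, Complex.sub_im, Complex.im_ofReal_mul, Complex.ofReal_im, Complex.mul_im]; ring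
      rw [a1, a2, mul_pow, div_pow, h3]
      have : w.im ^ 2 = 1 - w.re ^ 2 := by linarith
      have h4 : (-(w.re * w.im) / 2) * (-(w.re * w.im) / 2) = w.re ^ 2 * w.im ^ 2 / 4 := by ring
      rw [h4, this]; ring
    rw [e1, e2]
    have e3 : (p.map Complex.ofRealHom).eval ((√3 / 2 * w.re : ℝ) : ℂ)
        = ((p.eval (√3 / 2 * w.re) : ℝ) : ℂ) := by
      rw [Polynomial.eval_map]
      exact Polynomial.eval₂_at_apply Complex.ofRealHom _
    rw [e3, Complex.norm_real, Real.norm_eq_abs]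
    apply h
    rw [abs_mul, abs_of_nonneg (by positivity)]
    have : |w.re| ≤ 1 := hw ▸ Complex.abs_re_le_norm w
    nlinarith [Real.sqrt_nonneg 3]
  have := Complex.norm_le_of_forall_mem_frontier_norm_le (Metric.isBounded_ball)
    (hd.diffContOnCl) hb (z := (u : ℂ)) (by
      rw [closure_ball _ one_ne_zero]; simpa using hu)
  rw [hG _ (by exact_mod_cast hu0)] at this
  have e3 : (p.map Complex.ofRealHom).eval (((√3 / 4 : ℝ) : ℂ) * (u + (u : ℂ)⁻¹))
        = ((p.eval (√3 / 4 * (u + u⁻¹)) : ℝ) : ℂ) := by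
    rw [Polynomial.eval_map]
    have : (((√3 / 4 : ℝ) : ℂ) * (u + (u : ℂ)⁻¹)) = Complex.ofRealHom (√3 / 4 * (u + u⁻¹)) := by
      simp
    rw [this]
    exact Polynomial.eval₂_at_apply Complex.ofRealHom _
  have e4 : ((u : ℂ) * (3 / 4 * (1 - (u : ℂ) ^ 2 / 3))) = ((u * (3 / 4 * (1 - u ^ 2 / 3)) : ℝ) : ℂ) := by
    push_cast; ring
  rw [e3, e4, norm_mul, norm_pow, Complex.norm_real, Complex.norm_real, Real.norm_eq_abs,
    Real.norm_eq_abs, abs_mul u, abs_of_nonneg (a := (3 / 4 * (1 - u ^ 2 / 3)))] at this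
  · exact this
  · have : u ^ 2 ≤ 1 := by rw [← sq_abs]; nlinarith [abs_nonneg u]
    nlinarith

lemma exists_u (t : ℝ) (h1 : √3 / 2 ≤ |t|) (h2 : |t| ≤ 1) :
    ∃ u : ℝ, 1 / 3 ≤ u ^ 2 ∧ |u| ≤ 1 ∧ t = √3 / 4 * (u + u⁻¹) := by
  have h3 : √3 ^ 2 = 3 := Real.sq_sqrt (by norm_num)
  have h30 : 0 < √3 := by positivity
  wlog ht : 0 ≤ t generalizing t
  · obtain ⟨u, a, b, c⟩ := this (-t) (by simpa using h1) (by simpa using h2) (by linarith)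
    refine ⟨-u, by simpa using a, by simpa using b, ?_⟩
    rw [inv_neg]; linarith
  rw [abs_of_nonneg ht] at h1 h2
  have h31 : (√3)⁻¹ ≤ 1 := by
    rw [inv_le_one₀ h30]; nlinarith
  have hc : ContinuousOn (fun u : ℝ => √3 / 4 * (u + u⁻¹)) (Set.Icc (√3)⁻¹ 1) := by
    refine ContinuousOn.mul continuousOn_const (continuousOn_id.add (continuousOn_id.inv₀ ?_))
    intro x hx
    have : 0 < x := lt_of_lt_of_le (by positivity) hx.1
    exact this.ne'
  obtain ⟨u, hu, hut⟩ := intermediate_value_Icc' h31 hc (show t ∈ _ from by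
    constructor
    · norm_num; linarith
    · refine h2.trans (le_of_eq ?_)
      field_simp; nlinarith)
  have hu0 : 0 < u := lt_of_lt_of_le (by positivity) hu.1
  refine ⟨u, ?_, by rw [abs_of_pos hu0]; exact hu.2, hut.symm⟩
  have : (√3)⁻¹ ^ 2 = 1 / 3 := by rw [inv_pow, h3]; norm_num
  rw [← this]
  exact pow_le_pow_left₀ (by positivity) hu.1 2

lemma uni (k : ℕ) (p : Polynomial ℝ) (hp : p.natDegree ≤ k) (M : ℝ)
    (h : ∀ t : ℝ, |t| ≤ √3 / 2 → |p.eval t| * (√(1 - t ^ 2)) ^ k ≤ M)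
    (t : ℝ) (ht : |t| ≤ 1) :
    |p.eval t| * (√(1 - t ^ 2)) ^ k ≤ M ∧ |p.eval t| * (1 / 4) ^ k ≤ M := by
  have h3 : √3 ^ 2 = 3 := Real.sq_sqrt (by norm_num)
  have h30 : 0 < √3 := by positivity
  rcases le_or_gt (|t|) (√3 / 2) with h1 | h1
  · refine ⟨h t h1, le_trans ?_ (h t h1)⟩
    gcongr
    apply Real.le_sqrt_of_sq_le
    have : t ^ 2 ≤ (√3 / 2) ^ 2 := by rw [← sq_abs]; gcongr
    rw [div_pow, h3] at this
    linarith
  · obtain ⟨u, ha, hb, hc⟩ := exists_u t h1.le ht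
    have hu0 : u ≠ 0 := by rintro rfl; norm_num at ha
    have key := uni_disk k p hp M h u hu0 hb
    rw [← hc] at key
    have hu1 : u ^ 2 ≤ 1 := by rw [← sq_abs]; nlinarith [abs_nonneg u]
    have hpos : 0 ≤ |u| * (3 / 4 * (1 - u ^ 2 / 3)) := by
      have : 0 ≤ 1 - u ^ 2 / 3 := by linarith
      positivity
    have hsq : (|u| * (3 / 4 * (1 - u ^ 2 / 3))) ^ 2 = u ^ 2 * (9 / 16 * (1 - u ^ 2 / 3) ^ 2) := by
      rw [mul_pow, sq_abs]; ring
    constructor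
    · refine le_trans ?_ key
      gcongr
      apply Real.sqrt_le_iff.mpr ⟨hpos, ?_⟩
      rw [hsq, hc, mul_pow, div_pow, h3]
      have : (u + u⁻¹) ^ 2 = (u ^ 2 + 1) ^ 2 / u ^ 2 := by field_simp
      rw [this]
      set v := u ^ 2 with hv
      have hv0 : 0 < v := by linarith
      have : 1 - 3 / 4 ^ 2 * ((v + 1) ^ 2 / v) = (16 * v - 3 * (v + 1) ^ 2) / (16 * v) := by
        field_simp; ring
      rw [this, div_le_iff₀ (by positivity)]
      have : 0 ≤ (3 - v) * (1 - v) ^ 3 := mul_nonneg (by linarith) (pow_nonneg (by linarith) 3)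
      nlinarith
    · refine le_trans ?_ key
      gcongr
      apply le_of_sq_le_sq _ hpos
      rw [hsq]
      nlinarith [sq_nonneg (1 - u ^ 2 / 3), mul_nonneg (sub_nonneg.mpr ha) (sq_nonneg (1 - u ^ 2 / 3))]


lemma tri_sum (y : ℝ) (hy : |y| ≤ 1 / 4) :
    HasSum (fun m : ℕ => (-1 : ℝ) ^ m / (2 * m + 1) ^ 2 * Real.sin (2 * π * (2 * m + 1) * y))
      (π ^ 2 * y / 2) := by
  rw [abs_le] at hy
  have B : ∀ x : ℝ, x ∈ Set.Icc (0 : ℝ) 1 →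
      HasSum (fun n : ℕ => 1 / (n : ℝ) ^ 2 * Real.cos (2 * π * n * x))
        (π ^ 2 * (x ^ 2 - x + 1 / 6)) := by
    intro x hx
    have := hasSum_one_div_nat_pow_mul_cos one_ne_zero hx
    rw [Polynomial.bernoulli_def] at this
    have e : ((-1 : ℝ) ^ (1 + 1) * (2 * π) ^ (2 * 1) / 2 / ((2 * 1).factorial : ℝ) * Polynomial.eval x
        (Polynomial.map (algebraMap ℚ ℝ) (∑ i ∈ Finset.range (2 * 1 + 1),
          Polynomial.monomial i (_root_.bernoulli (2 * 1 - i) * ((2 * 1).choose i))))) =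
        π ^ 2 * (x ^ 2 - x + 1 / 6) := by
      simp [Finset.sum_range_succ, bernoulli_one, bernoulli_two, Polynomial.map_monomial,
        Polynomial.eval_monomial]
      ring
    rw [e] at this
    exact this
  have h1 := B (1 / 4 - y) ⟨by linarith, by linarith⟩
  have h2 := B (2 * (1 / 4 - y)) ⟨by linarith, by linarith⟩
  set F : ℕ → ℝ := fun n : ℕ => 1 / (n : ℝ) ^ 2 * Real.cos (2 * π * n * (1 / 4 - y)) with hF
  have he : HasSum (fun m => F (2 * m)) (1 / 4 * (π ^ 2 * ((2 * (1 / 4 - y)) ^ 2 - 2 * (1 / 4 - y) + 1 / 6))) := by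
    refine (h2.mul_left (1 / 4)).congr_fun ?_ |> fun h => h
    intro m
    simp only [hF]
    push_cast
    rw [show 2 * π * m * (2 * (1 / 4 - y)) = 2 * π * (2 * m) * (1 / 4 - y) by ring]
    ring
  have ho : Summable (fun m => F (2 * m + 1)) :=
    h1.summable.comp_injective (fun a b h => by simpa using h)
  have ht := he.even_add_odd ho.hasSum
  have heq := ht.unique h1
  have hval : ∑' m, F (2 * m + 1) = π ^ 2 * y / 2 := by linarith
  have := ho.hasSum
  rw [hval] at this
  convert this using 1
  ext m
  simp only [hF]
  push_cast
  have : Real.cos (2 * π * (2 * m + 1) * (1 / 4 - y)) = (-1) ^ m * Real.sin (2 * π * (2 * m + 1) * y) := by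
    rw [show 2 * π * (2 * m + 1) * (1 / 4 - y) = (π / 2 - 2 * π * (2 * m + 1) * y) + m * π by ring,
      Real.cos_add_nat_mul_pi, Real.cos_pi_div_two_sub]
  rw [this]; ring

lemma odd_sum : HasSum (fun m : ℕ => (1 : ℝ) / (2 * m + 1) ^ 2) (π ^ 2 / 8) := by
  have := tri_sum (1 / 4) (by norm_num [abs_of_pos])
  convert this using 1
  · ext m
    have : Real.sin (2 * π * (2 * m + 1) * (1 / 4)) = (-1) ^ m := by
      rw [show 2 * π * (2 * m + 1) * (1 / 4) = π / 2 + m * π by ring, Real.sin_add_nat_mul_pi]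
      simp
    rw [this, div_mul_eq_mul_div, ← mul_pow]; norm_num
  · ring

/-- trigonometric sums with frequencies at most `N` -/
def TB (N : ℝ) : Submodule ℂ (ℝ → ℂ) :=
  Submodule.span ℂ {g | ∃ l : ℝ, |l| ≤ N ∧ g = fun s : ℝ => Complex.exp (Complex.I * (l * s))}

lemma TB_mono {N M : ℝ} (h : N ≤ M) : TB N ≤ TB M :=
  Submodule.span_mono (by rintro g ⟨l, hl, rfl⟩; exact ⟨l, hl.trans h, rfl⟩)

lemma TB_mul {N M : ℝ} {f g : ℝ → ℂ} (hf : f ∈ TB N) (hg : g ∈ TB M) : f * g ∈ TB (N + M) := by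
  have := Submodule.mul_mem_mul hf hg
  unfold TB at this
  rw [Submodule.span_mul_span] at this
  refine Submodule.span_mono ?_ this
  rintro _ ⟨_, ⟨l, hl, rfl⟩, _, ⟨m, hm, rfl⟩, rfl⟩
  refine ⟨l + m, (abs_add_le _ _).trans (add_le_add hl hm), ?_⟩
  ext s
  simp only [Pi.mul_apply, ← Complex.exp_add]
  congr 1
  push_cast; ring

lemma TB_exp {N : ℝ} (l : ℝ) (hl : |l| ≤ N) :
    (fun s : ℝ => Complex.exp (Complex.I * (l * s))) ∈ TB N := Submodule.subset_span ⟨l, hl, rfl⟩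

lemma TB_const {N : ℝ} (hN : 0 ≤ N) (c : ℂ) : (fun _ : ℝ => c) ∈ TB N := by
  have := (TB N).smul_mem c (TB_exp (N := N) 0 (by simpa using hN))
  convert this using 1
  ext s; simp

lemma TB_pow {N : ℝ} {f : ℝ → ℂ} (hf : f ∈ TB N) (m : ℕ) : f ^ m ∈ TB (m * N) := by
  induction m with
  | zero => simp only [Nat.cast_zero, zero_mul, pow_zero, Finset.prod_empty, Finset.sum_empty]; exact TB_const (N := 0) le_rfl 1
  | succ m ih =>
    rw [pow_succ]
    have := TB_mul ih hf
    convert this using 2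
    push_cast; ring

lemma TB_prod {ι : Type*} (S : Finset ι) (N : ι → ℝ) (f : ι → ℝ → ℂ) (hf : ∀ i ∈ S, f i ∈ TB (N i)) :
    ∏ i ∈ S, f i ∈ TB (∑ i ∈ S, N i) := by
  classical
  induction S using Finset.induction_on with
  | empty => simp only [Nat.cast_zero, zero_mul, pow_zero, Finset.prod_empty, Finset.sum_empty]; exact TB_const (N := 0) le_rfl 1
  | insert a S ha ih =>
    rw [Finset.prod_insert ha, Finset.sum_insert ha]
    exact TB_mul (hf a (by simp)) (ih fun i hi => hf i (by simp [hi]))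

lemma TB_cos {N : ℝ} (a v : ℝ) (hv : |v| ≤ N) :
    (fun s : ℝ => ((Real.cos (a + s * v) : ℝ) : ℂ)) ∈ TB N := by
  have h1 := (TB N).smul_mem (Complex.exp (Complex.I * a) / 2) (TB_exp v hv)
  have h2 := (TB N).smul_mem (Complex.exp (-(Complex.I * a)) / 2) (TB_exp (-v) (by simpa using hv))
  convert (TB N).add_mem h1 h2 using 1
  ext s
  simp only [Pi.add_apply, Pi.smul_apply, smul_eq_mul]
  rw [Complex.ofReal_cos, Complex.cos, div_mul_eq_mul_div, div_mul_eq_mul_div, ← Complex.exp_add,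
    ← Complex.exp_add, ← add_div]
  push_cast
  congr 3 <;> ring

lemma TB_sin {N : ℝ} (a v : ℝ) (hv : |v| ≤ N) :
    (fun s : ℝ => ((Real.sin (a + s * v) : ℝ) : ℂ)) ∈ TB N := by
  convert TB_cos (a - π / 2) v hv using 3 with s
  rw [show a - π / 2 + s * v = (a + s * v) - π / 2 by ring, Real.cos_sub_pi_div_two]

lemma hasSum_cg {f g : ℕ → ℂ} {a b : ℂ} (h : HasSum f a) (hfg : ∀ m, g m = f m) (hab : b = a) :
    HasSum g b := by
  rw [hab, show g = f from funext hfg]; exact h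

lemma TB_key {N : ℝ} (hN : 0 < N) {g : ℝ → ℂ} (hg : g ∈ TB N) (s : ℝ) :
    ∃ d : ℂ, HasDerivAt g d s ∧
      HasSum (fun m : ℕ => (((-1 : ℝ) ^ m / (2 * m + 1) ^ 2 : ℝ) : ℂ) *
        (g (s + (2 * m + 1) * (π / (2 * N))) - g (s - (2 * m + 1) * (π / (2 * N)))))
        ((π ^ 2 / (4 * N) : ℝ) * d) := by
  unfold TB at hg
  induction hg using Submodule.span_induction with
  | mem g hg =>
    obtain ⟨l, hl, rfl⟩ := hg
    refine ⟨Complex.exp (Complex.I * (l * s)) * (Complex.I * l), ?_, ?_⟩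
    · have h0 : HasDerivAt (fun s : ℝ => (s : ℂ)) 1 s := Complex.ofRealCLM.hasDerivAt
      have h1 : HasDerivAt (fun s : ℝ => Complex.I * ((l : ℂ) * (s : ℂ))) (Complex.I * l) s := by
        simpa using (h0.const_mul (l : ℂ)).const_mul Complex.I
      exact h1.cexp
    · have hy : |l / (4 * N)| ≤ 1 / 4 := by
        rw [abs_div, abs_of_pos (show 0 < 4 * N by positivity), div_le_iff₀ (by positivity)]
        linarith
      have h := (Complex.hasSum_ofReal.mpr (tri_sum _ hy)).mul_left
        (2 * Complex.I * Complex.exp (Complex.I * (l * s)))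
      refine hasSum_cg h ?_ ?_
      · intro m
        rw [Complex.ofReal_mul, Complex.ofReal_sin, Complex.sin]
        have e : ((2 * π * (2 * m + 1) * (l / (4 * N)) : ℝ) : ℂ) = l * ((2 * m + 1) * (π / (2 * N)) : ℝ) := by
          have : (N : ℂ) ≠ 0 := by exact_mod_cast hN.ne'
          push_cast; field_simp; ring
        rw [e]
        set t : ℝ := (2 * m + 1) * (π / (2 * N))
        have e1 : Complex.exp (Complex.I * (l * ((s + t : ℝ) : ℂ))) =
            Complex.exp (Complex.I * (l * s)) * Complex.exp (l * t * Complex.I) := by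
          rw [← Complex.exp_add]; congr 1; push_cast; ring
        have e2 : Complex.exp (Complex.I * (l * ((s - t : ℝ) : ℂ))) =
            Complex.exp (Complex.I * (l * s)) * Complex.exp (-(l * t) * Complex.I) := by
          rw [← Complex.exp_add]; congr 1; push_cast; ring
        beta_reduce
        rw [e1, e2]
        linear_combination ((((-1 : ℝ) ^ m / (2 * m + 1) ^ 2 : ℝ) : ℂ) * Complex.exp (Complex.I * (l * s)) *
          (Complex.exp (l * t * Complex.I) - Complex.exp (-(l * t) * Complex.I))) * Complex.I_sq
      · have : (N : ℂ) ≠ 0 := by exact_mod_cast hN.ne'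
        push_cast
        field_simp
        try ring
  | zero => exact ⟨0, hasDerivAt_const _ _, by simpa using hasSum_zero⟩
  | add f g _ _ hf hg =>
    obtain ⟨d, hd, hs⟩ := hf
    obtain ⟨d', hd', hs'⟩ := hg
    refine ⟨d + d', hd.add hd', ?_⟩
    refine hasSum_cg (hs.add hs') ?_ ?_
    · intro m; simp only [Pi.add_apply]; ring
    · ring
  | smul c f _ hf =>
    obtain ⟨d, hd, hs⟩ := hf
    refine ⟨c * d, hd.const_mul c, ?_⟩
    refine hasSum_cg (hs.mul_left c) ?_ ?_
    · intro m; simp only [Pi.smul_apply, smul_eq_mul]; ring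
    · ring

lemma TB_bernstein {N M : ℝ} (hN : 0 < N) {g : ℝ → ℂ} (hg : g ∈ TB N) (hM : ∀ s, ‖g s‖ ≤ M) :
    ‖g 1 - g 0‖ ≤ N * M := by
  choose d hd hs using TB_key hN hg
  have hb : ∀ s, ‖d s‖ ≤ N * M := by
    intro s
    have h1 : HasSum (fun m : ℕ => (1 : ℝ) / (2 * m + 1) ^ 2 * (2 * M)) (π ^ 2 / 8 * (2 * M)) :=
      odd_sum.mul_right _
    have h2 := (hs s).norm_le_of_bounded h1 (by
      intro m
      rw [norm_mul, Complex.norm_real, norm_div, norm_pow, norm_neg, norm_one, one_pow,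
        Real.norm_of_nonneg (by positivity)]
      gcongr
      refine (norm_sub_le _ _).trans ?_
      linarith [hM (s + (2 * m + 1) * (π / (2 * N))), hM (s - (2 * m + 1) * (π / (2 * N)))])
    rw [norm_mul, Complex.norm_real, Real.norm_of_nonneg (by positivity), div_mul_eq_mul_div,
      div_le_iff₀ (by positivity)] at h2
    have hp : 0 < π ^ 2 := by positivity
    have : π ^ 2 * ‖d s‖ ≤ π ^ 2 * (N * M) := by linarith
    exact le_of_mul_le_mul_left this hp
  have := Convex.norm_image_sub_le_of_norm_hasDerivWithin_le (f := g) (f' := d) (s := Set.univ)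
    (x := 0) (y := 1) (fun s _ => (hd s).hasDerivWithinAt) (fun s _ => hb s) convex_univ trivial trivial
  simpa using this

lemma tensor (n k : ℕ) (w w2 : ℝ → ℝ) (hw : ∀ t, 0 ≤ w t) (hw2 : ∀ t, 0 ≤ w2 t)
    (huni : ∀ p : Polynomial ℝ, p.natDegree ≤ k → ∀ M : ℝ,
      (∀ t : ℝ, |t| ≤ √3 / 2 → |p.eval t| * w t ≤ M) → ∀ t : ℝ, |t| ≤ 1 → |p.eval t| * w2 t ≤ M)
    (F : (Fin n → ℝ) → ℝ)
    (hF : ∀ x i, ∃ p : Polynomial ℝ, p.natDegree ≤ k ∧ ∀ t, F (Function.update x i t) = p.eval t)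
    (M : ℝ) (h : ∀ x : Fin n → ℝ, (∀ i, |x i| ≤ √3 / 2) → |F x| * ∏ i, w (x i) ≤ M) :
    ∀ x : Fin n → ℝ, (∀ i, |x i| ≤ 1) → |F x| * ∏ i, w2 (x i) ≤ M := by
  classical
  have key : ∀ S : Finset (Fin n), ∀ x : Fin n → ℝ, (∀ i ∈ S, |x i| ≤ 1) →
      (∀ i, i ∉ S → |x i| ≤ √3 / 2) →
      |F x| * ∏ i, (if i ∈ S then w2 (x i) else w (x i)) ≤ M := by
    intro S
    induction S using Finset.induction_on with
    | empty => intro x _ hx; simpa using h x (fun i => hx i (by simp))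
    | insert a S ha ih =>
      intro x hx1 hx2
      set R : ℝ := ∏ i ∈ Finset.univ.erase a, (if i ∈ S then w2 (x i) else w (x i)) with hR
      have hR0 : 0 ≤ R := Finset.prod_nonneg fun i _ => by split_ifs <;> [exact hw2 _; exact hw _]
      obtain ⟨p, hp, hpe⟩ := hF x a
      have := huni (Polynomial.C R * p) ((Polynomial.natDegree_C_mul_le _ _).trans hp) M (by
        intro t ht
        have h1 := ih (Function.update x a t) (by
            intro i hi
            have : i ≠ a := by rintro rfl; exact ha hi
            rw [Function.update_of_ne this]
            exact hx1 i (by simp [hi])) (by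
            intro i hi
            by_cases hia : i = a
            · subst hia; simpa using ht
            · rw [Function.update_of_ne hia]
              exact hx2 i (by simp [hi, hia]))
        rw [← Finset.mul_prod_erase _ _ (Finset.mem_univ a), if_neg ha, Function.update_self,
          hpe] at h1
        have h2 : ∏ i ∈ Finset.univ.erase a, (if i ∈ S then w2 (Function.update x a t i)
            else w (Function.update x a t i)) = R := by
          refine Finset.prod_congr rfl fun i hi => ?_
          rw [Function.update_of_ne (Finset.ne_of_mem_erase hi)]
        rw [h2] at h1
        rw [Polynomial.eval_mul, Polynomial.eval_C, abs_mul, abs_of_nonneg hR0]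
        linarith) (x a) (hx1 a (by simp))
      rw [Polynomial.eval_mul, Polynomial.eval_C, abs_mul, abs_of_nonneg hR0, ← hpe,
        Function.update_eq_self] at this
      rw [← Finset.mul_prod_erase _ _ (Finset.mem_univ a), if_pos (by simp)]
      have h2 : ∏ i ∈ Finset.univ.erase a, (if i ∈ insert a S then w2 (x i)
            else w (x i)) = R := by
        refine Finset.prod_congr rfl fun i hi => ?_
        simp [Finset.ne_of_mem_erase hi]
      rw [h2]
      linarith
  intro x hx
  simpa using key Finset.univ x (fun i _ => hx i) (by simp)

lemma slice (n k : ℕ) (P : MvPolynomial (Fin n) ℝ) (hP : P.totalDegree ≤ k) (z : Fin n → ℝ) (b : ℝ)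
    (x : Fin n → ℝ) (i : Fin n) : ∃ p : Polynomial ℝ, p.natDegree ≤ k ∧
      ∀ t, MvPolynomial.eval (fun l => z l + b / 2 * (1 + Function.update x i t l)) P = p.eval t := by
  classical
  refine ⟨MvPolynomial.aeval (fun l => Polynomial.C (z l + b / 2) + Polynomial.C (b / 2) *
    (if l = i then Polynomial.X else Polynomial.C (x l))) P, ?_, ?_⟩
  · have := MvPolynomial.aeval_natDegree_le (n := 1) P hP (fun l => Polynomial.C (z l + b / 2) +
      Polynomial.C (b / 2) * (if l = i then Polynomial.X else Polynomial.C (x l))) (by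
        intro l
        refine (Polynomial.natDegree_add_le _ _).trans (max_le (by simp) ?_)
        refine (Polynomial.natDegree_C_mul_le _ _).trans ?_
        split_ifs
        · simp
        · simp)
    simpa using this
  · intro t
    rw [← Polynomial.coe_evalRingHom, MvPolynomial.aeval_def, MvPolynomial.hom_eval₂]
    rw [MvPolynomial.eval, MvPolynomial.coe_eval₂Hom]
    congr 1
    · ext r; simp
    · ext l
      by_cases hl : l = i
      · subst hl; simp; ring
      · simp [hl]; ring

lemma TB_main (n k : ℕ) (P : MvPolynomial (Fin n) ℝ) (hP : P.totalDegree ≤ k) (z : Fin n → ℝ) (b : ℝ)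
    (θ v : Fin n → ℝ) (V : ℝ) (hV0 : 0 ≤ V) (hV : ∀ i, |v i| ≤ V) :
    (fun s : ℝ => ((MvPolynomial.eval (fun l => z l + b / 2 * (1 + Real.sin (θ l + s * v l))) P *
      ∏ i, Real.cos (θ i + s * v i) ^ k : ℝ) : ℂ)) ∈ TB ((k + n * k) * V) := by
  have h1 : (fun s : ℝ => ((MvPolynomial.eval (fun l => z l + b / 2 * (1 + Real.sin (θ l + s * v l))) P
      : ℝ) : ℂ)) ∈ TB (k * V) := by
    have e : (fun s : ℝ => ((MvPolynomial.eval (fun l => z l + b / 2 * (1 + Real.sin (θ l + s * v l))) P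
      : ℝ) : ℂ)) = ∑ d ∈ P.support, ((P.coeff d : ℝ) : ℂ) • ∏ i, (fun s : ℝ =>
        ((z i + b / 2 : ℝ) : ℂ) + ((b / 2 : ℝ) : ℂ) * ((Real.sin (θ i + s * v i) : ℝ) : ℂ)) ^ d i := by
      ext s
      rw [MvPolynomial.eval_eq']
      simp only [Finset.sum_apply, Pi.smul_apply, Finset.prod_apply, Pi.pow_apply, smul_eq_mul]
      push_cast
      refine Finset.sum_congr rfl fun d _ => ?_
      congr 1
      refine Finset.prod_congr rfl fun i _ => ?_
      congr 1
      ring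
    rw [e]
    refine Submodule.sum_mem _ fun d hd => Submodule.smul_mem _ _ ?_
    have h2 := TB_prod Finset.univ (fun i => (d i : ℝ) * V) (fun i => (fun s : ℝ =>
        ((z i + b / 2 : ℝ) : ℂ) + ((b / 2 : ℝ) : ℂ) * ((Real.sin (θ i + s * v i) : ℝ) : ℂ)) ^ d i) (by
      intro i _
      refine TB_pow ?_ _
      exact Submodule.add_mem _ (TB_const hV0 _)
        (Submodule.smul_mem _ (((b / 2 : ℝ) : ℂ)) (TB_sin (θ i) (v i) (hV i))))
    refine TB_mono ?_ h2
    rw [← Finset.sum_mul]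
    gcongr
    have := (MvPolynomial.le_totalDegree hd).trans hP
    rw [Finsupp.sum_fintype _ _ (by simp)] at this
    exact_mod_cast this
  have h2 := TB_prod Finset.univ (fun _ : Fin n => (k : ℝ) * V) (fun i => (fun s : ℝ =>
        ((Real.cos (θ i + s * v i) : ℝ) : ℂ)) ^ k) (by
      intro i _
      exact TB_pow (TB_cos (θ i) (v i) (hV i)) _)
  have h3 := TB_mul h1 h2
  convert h3 using 1
  · congr 1
    simp; ring
  · ext s
    simp [Finset.prod_apply]

lemma arcsin_lip (c x y : ℝ) (hc : c < 1) (hx : |x| ≤ c) (hy : |y| ≤ c) :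
    |Real.arcsin y - Real.arcsin x| ≤ 1 / √(1 - c ^ 2) * |y - x| := by
  have hc0 : 0 ≤ c := (abs_nonneg x).trans hx
  have := Convex.norm_image_sub_le_of_norm_hasDerivWithin_le (f := Real.arcsin)
    (f' := fun t => 1 / √(1 - t ^ 2)) (s := Set.Icc (-c) c) (C := 1 / √(1 - c ^ 2))
    (x := x) (y := y) (by
      intro t ht
      exact (Real.hasDerivAt_arcsin (by linarith [ht.1]) (by linarith [ht.2])).hasDerivWithinAt) (by
      intro t ht
      rw [Real.norm_of_nonneg (by positivity)]
      have h1 : 0 < 1 - c ^ 2 := by nlinarith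
      have h2 : t ^ 2 ≤ c ^ 2 := sq_le_sq' ht.1 ht.2
      gcongr) (convex_Icc _ _) (abs_le.mp hx) (abs_le.mp hy)
  simpa using this

lemma num_ineq (r s : ℝ) (hr0 : 0 ≤ r) (hr : r ≤ 1 / 2) (hs : s ^ 2 = 3) (hs0 : 0 ≤ s) :
    (1 - r) ^ 2 / 4 ≤ (1 - r / 4) ^ 2 * (1 - (s / 2 + r / 6) ^ 2) := by
  have h1 : s ≤ 1.74 := by nlinarith
  have h2 : 1 - (s / 2 + r / 6) ^ 2 ≥ 1 / 4 - 0.29 * r - r ^ 2 / 36 := by nlinarith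
  have h3 : (1 - r / 4) ^ 2 * (1 / 4 - 0.29 * r - r ^ 2 / 36) ≤
    (1 - r / 4) ^ 2 * (1 - (s / 2 + r / 6) ^ 2) := by gcongr
  refine le_trans ?_ h3
  have : (1 - r / 4) ^ 2 * (1 / 4 - 0.29 * r - r ^ 2 / 36) - (1 - r) ^ 2 / 4 =
    r * (0.085 - r * (1/4 - 0.145 + 1/36 - 1 / 64) - r ^ 2 * (0.29 / 16 - 1/72) - r ^ 3 / 576) := by ring
  have h4 : 0 ≤ 0.085 - r * (1/4 - 0.145 + 1/36 - 1 / 64) - r ^ 2 * (0.29 / 16 - 1/72) - r ^ 3 / 576 := by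
    have : r ^ 2 ≤ 1 / 4 := by nlinarith
    have : r ^ 3 ≤ 1 := pow_le_one₀ hr0 (by linarith)
    nlinarith
  nlinarith [mul_nonneg hr0 h4]

lemma angle (n k : ℕ) (hn : 2 ≤ n) (q : ℕ) (hq : (4 * (n + 1) : ℝ) * (k + 1) ≤ q)
    (x y : Fin n → ℝ) (hx : ∀ i, |x i| ≤ √3 / 2) (hxy : ∀ i, |y i - x i| ≤ 2 / q) :
    ∃ V : ℝ, 0 ≤ V ∧ (∀ i, |Real.arcsin (y i) - Real.arcsin (x i)| ≤ V) ∧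
      (k + n * k) * V ≤ 1 - 1 / (4 * (k + 1) : ℝ) := by
  rcases Nat.eq_zero_or_pos k with rfl | hk
  · refine ⟨∑ i, |Real.arcsin (y i) - Real.arcsin (x i)|, by positivity, fun i => ?_, by norm_num⟩
    exact Finset.single_le_sum (f := fun i => |Real.arcsin (y i) - Real.arcsin (x i)|)
      (fun _ _ => abs_nonneg _) (Finset.mem_univ i)
  have hs : √3 ^ 2 = 3 := Real.sq_sqrt (by norm_num)
  have hs0 : 0 ≤ √3 := Real.sqrt_nonneg _
  have hn' : (2 : ℝ) ≤ n := by exact_mod_cast hn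
  have hk' : (1 : ℝ) ≤ k := by exact_mod_cast hk
  set r : ℝ := 1 / (k + 1) with hr
  have hr0 : 0 < r := by positivity
  have hr2 : r ≤ 1 / 2 := by rw [hr]; gcongr; linarith
  have hkr : k * r = 1 - r := by rw [hr]; field_simp; ring
  have hq0 : (0 : ℝ) < q := lt_of_lt_of_le (by positivity) hq
  have hδ : 2 / (q : ℝ) ≤ r / (2 * (n + 1)) := by
    rw [hr, div_div, div_le_div_iff₀ hq0 (by positivity)]
    linarith
  have hδ6 : r / (2 * (n + 1)) ≤ r / 6 := by gcongr; linarith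
  set c : ℝ := √3 / 2 + r / 6 with hc
  have hni := num_ineq r (√3) hr0.le hr2 hs hs0
  rw [← hc] at hni
  have hcpos : 0 < 1 - c ^ 2 := by
    by_contra hcon
    have : 0 < (1 - r) ^ 2 / 4 := by
      have : 0 < 1 - r := by linarith
      positivity
    nlinarith [sq_nonneg (1 - r / 4)]
  have hc0 : 0 ≤ c := by positivity
  have hc1 : c < 1 := by nlinarith
  refine ⟨1 / √(1 - c ^ 2) * (r / (2 * (n + 1))), by positivity, fun i => ?_, ?_⟩
  · refine (arcsin_lip c (x i) (y i) hc1 ((hx i).trans (by linarith)) ?_).trans ?_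
    · have := abs_sub_abs_le_abs_sub (y i) (x i)
      linarith [hx i, hxy i]
    · have := (hxy i).trans hδ
      gcongr
  · have e : (k + n * k) * (1 / √(1 - c ^ 2) * (r / (2 * (n + 1)))) = ((1 - r) / 2) / √(1 - c ^ 2) := by
      rw [← hkr]
      have : √(1 - c ^ 2) ≠ 0 := (Real.sqrt_pos.mpr hcpos).ne'
      field_simp
      ring
    have e2 : 1 - 1 / (4 * (k + 1) : ℝ) = 1 - r / 4 := by rw [hr]; field_simp
    rw [e, e2, div_le_iff₀ (Real.sqrt_pos.mpr hcpos)]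
    apply le_of_sq_le_sq
    · rw [mul_pow, Real.sq_sqrt hcpos.le, div_pow]
      linarith
    · have : 0 ≤ 1 - r / 4 := by linarith
      positivity

lemma cell (q : ℕ) (hq : 0 < q) (s : ℝ) (h0 : 0 ≤ s) (h1 : s ≤ 1) :
    ∃ j : Fin q, (j : ℝ) / q ≤ s ∧ s ≤ ((j : ℝ) + 1) / q := by
  have hq' : (0 : ℝ) < q := by exact_mod_cast hq
  rcases h1.lt_or_eq with h | h
  · refine ⟨⟨⌊s * q⌋₊, ?_⟩, ?_, ?_⟩
    · rw [Nat.floor_lt (by positivity)]; nlinarith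
    · rw [div_le_iff₀ hq']; exact Nat.floor_le (by positivity)
    · rw [le_div_iff₀ hq']; exact (Nat.lt_floor_add_one _).le
  · refine ⟨⟨q - 1, by omega⟩, ?_, ?_⟩
    · rw [h, div_le_iff₀ hq', one_mul]; simp
    · rw [h, le_div_iff₀ hq', one_mul]
      push_cast [Nat.cast_sub (show 1 ≤ q from hq)]; linarith

lemma norming (n k : ℕ) (hn : 2 ≤ n) (q : ℕ) (hq : (4 * (n + 1) : ℝ) * (k + 1) ≤ q)
    (z : Fin n → ℝ) (b : ℝ) (hb : 0 < b)
    (y : (Fin n → Fin q) → (Fin n → ℝ))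
    (hy : ∀ j : Fin n → Fin q, ∀ i : Fin n,
      z i + (j i : ℝ) * (b / q) ≤ y j i ∧ y j i ≤ z i + ((j i : ℝ) + 1) * (b / q))
    (x : Fin n → ℝ) (hx : ∀ i, z i ≤ x i ∧ x i ≤ z i + b)
    (P : MvPolynomial (Fin n) ℝ) (hP : P.totalDegree ≤ k) (B : ℝ)
    (hB : ∀ j, |MvPolynomial.eval (y j) P| ≤ B) :
    |MvPolynomial.eval x P| ≤ 4 ^ (n * k) * (4 * (k + 1)) * B := by
  set F : (Fin n → ℝ) → ℝ := fun t => MvPolynomial.eval (fun l => z l + b / 2 * (1 + t l)) P with hF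
  have hq0 : (0 : ℝ) < q := lt_of_lt_of_le (by positivity) hq
  have hs : √3 ^ 2 = 3 := Real.sq_sqrt (by norm_num)
  have hs0 : 0 ≤ √3 := Real.sqrt_nonneg _
  have hs2 : √3 ≤ 2 := by nlinarith
  have hFc : Continuous F := by
    simp only [hF]
    exact (MvPolynomial.continuous_eval P).comp (by fun_prop)
  obtain ⟨t, ht, hmax⟩ := (isCompact_Icc (a := fun _ : Fin n => -(√3 / 2)) (b := fun _ => √3 / 2)).exists_isMaxOn
    ⟨0, by constructor <;> intro i <;> simp <;> positivity⟩
    (f := fun t => |F t| * ∏ i, √(1 - t i ^ 2) ^ k) (by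
      apply Continuous.continuousOn
      refine (hFc.abs).mul ?_
      fun_prop)
  have hta : ∀ i, |t i| ≤ √3 / 2 := fun i => abs_le.mpr ⟨ht.1 i, ht.2 i⟩
  set M : ℝ := |F t| * ∏ i, √(1 - t i ^ 2) ^ k with hM
  have hMb : ∀ x : Fin n → ℝ, (∀ i, |x i| ≤ √3 / 2) → |F x| * ∏ i, √(1 - x i ^ 2) ^ k ≤ M := by
    intro x hx
    exact hmax (show x ∈ Set.Icc _ _ from ⟨fun i => (abs_le.mp (hx i)).1, fun i => (abs_le.mp (hx i)).2⟩)
  have hsl := fun x i => slice n k P hP z b x i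
  have T1 := tensor n k (fun t => √(1 - t ^ 2) ^ k) (fun t => √(1 - t ^ 2) ^ k)
    (fun _ => by positivity) (fun _ => by positivity)
    (fun p hp M h t ht => (uni k p hp M h t ht).1) F hsl M hMb
  have T2 := tensor n k (fun t => √(1 - t ^ 2) ^ k) (fun t => (1 / 4) ^ k)
    (fun _ => by positivity) (fun _ => by positivity)
    (fun p hp M h t ht => (uni k p hp M h t ht).2) F hsl M hMb
  -- the bound at x
  have hxF : |MvPolynomial.eval x P| ≤ 4 ^ (n * k) * M := by
    have := T2 (fun i => 2 * (x i - z i) / b - 1) (by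
      intro i
      have h1 : 0 ≤ (x i - z i) / b := div_nonneg (by linarith [hx i]) hb.le
      have h2 : (x i - z i) / b ≤ 1 := by rw [div_le_one hb]; linarith [hx i]
      rw [mul_div_assoc, abs_le]; constructor <;> linarith)
    have e : F (fun i => 2 * (x i - z i) / b - 1) = MvPolynomial.eval x P := by
      simp only [hF]
      congr 2
      ext l
      field_simp
      ring
    rw [e, Finset.prod_const, ← pow_mul, Finset.card_univ, Fintype.card_fin, mul_comm k n, div_pow,
      one_pow, mul_one_div, div_le_iff₀ (by positivity)] at this
    linarith
  -- the cell
  have hc : ∀ i, ∃ j : Fin q, (j : ℝ) / q ≤ (1 + t i) / 2 ∧ (1 + t i) / 2 ≤ ((j : ℝ) + 1) / q := by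
    intro i
    have := abs_le.mp (hta i)
    exact cell q (by exact_mod_cast hq0) _ (by linarith) (by linarith)
  choose j hj1 hj2 using hc
  set u : Fin n → ℝ := fun i => 2 * (y j i - z i) / b - 1 with hu
  have huj : ∀ i, (j i : ℝ) / q ≤ (1 + u i) / 2 ∧ (1 + u i) / 2 ≤ ((j i : ℝ) + 1) / q := by
    intro i
    have e : (1 + u i) / 2 = (y j i - z i) / b := by simp only [hu]; ring
    have := hy j i
    rw [e, le_div_iff₀ hb, div_le_iff₀ hb]
    constructor
    · have e : (j i : ℝ) / q * b = j i * (b / q) := by ring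
      linarith
    · have e : ((j i : ℝ) + 1) / q * b = (j i + 1) * (b / q) := by ring
      linarith
  have hu1 : ∀ i, |u i| ≤ 1 := by
    intro i
    have h1 : 0 ≤ (j i : ℝ) / q := by positivity
    have h2 : ((j i : ℝ) + 1) / q ≤ 1 := by
      rw [div_le_one hq0]; exact_mod_cast (j i).2
    have := huj i
    rw [abs_le]; constructor <;> linarith
  have hut : ∀ i, |u i - t i| ≤ 2 / q := by
    intro i
    have e : ((j i : ℝ) + 1) / q = j i / q + 1 / q := by ring
    have e2 : 2 / (q : ℝ) = 2 * (1 / q) := by ring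
    have := huj i
    have := hj1 i
    have := hj2 i
    rw [abs_le]; constructor <;> linarith
  obtain ⟨V, hV0, hV, hVN⟩ := angle n k hn q hq t u hta hut
  set N : ℝ := 1 - 1 / (4 * (k + 1) : ℝ) with hN
  have hN0 : 0 < N := by
    have : 1 / (4 * (k + 1) : ℝ) < 1 := by rw [div_lt_one (by positivity)]; linarith [(Nat.cast_nonneg k : (0:ℝ) ≤ k)]
    linarith
  have hTB := TB_mono hVN (TB_main n k P hP z b (fun i => Real.arcsin (t i))
    (fun i => Real.arcsin (u i) - Real.arcsin (t i)) V hV0 hV)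
  have hbern := TB_bernstein (M := M) hN0 hTB (by
    intro s
    rw [Complex.norm_real, Real.norm_eq_abs, abs_mul, Finset.abs_prod]
    have := T1 (fun l => Real.sin (Real.arcsin (t l) + s * (Real.arcsin (u l) - Real.arcsin (t l))))
      (fun i => Real.abs_sin_le_one _)
    refine le_trans (le_of_eq ?_) this
    simp only [hF]
    congr 1
    refine Finset.prod_congr rfl fun i _ => ?_
    rw [abs_pow, Real.abs_cos_eq_sqrt_one_sub_sin_sq])
  simp only [one_mul, zero_mul, add_zero, add_sub_cancel] at hbern
  rw [← Complex.ofReal_sub, Complex.norm_real, Real.norm_eq_abs] at hbern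
  have st : ∀ i, Real.sin (Real.arcsin (t i)) = t i := fun i => by
    have := abs_le.mp (hta i)
    exact Real.sin_arcsin (by linarith) (by linarith)
  have su : ∀ i, Real.sin (Real.arcsin (u i)) = u i := fun i => by
    have := abs_le.mp (hu1 i)
    exact Real.sin_arcsin (by linarith) (by linarith)
  simp only [st, su, Real.cos_arcsin] at hbern
  have eM : |MvPolynomial.eval (fun l => z l + b / 2 * (1 + t l)) P * ∏ i, √(1 - t i ^ 2) ^ k| = M := by
    rw [abs_mul, abs_of_nonneg (a := ∏ i, √(1 - t i ^ 2) ^ k) (Finset.prod_nonneg fun i _ => by positivity)]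
  have eU : |MvPolynomial.eval (fun l => z l + b / 2 * (1 + u l)) P * ∏ i, √(1 - u i ^ 2) ^ k| ≤ B := by
    rw [abs_mul, abs_of_nonneg (a := ∏ i, √(1 - u i ^ 2) ^ k) (Finset.prod_nonneg fun i _ => by positivity)]
    have h1 : ∏ i, √(1 - u i ^ 2) ^ k ≤ 1 := by
      apply Finset.prod_le_one (fun i _ => by positivity)
      intro i _
      apply pow_le_one₀ (by positivity)
      exact Real.sqrt_le_iff.mpr ⟨by norm_num, by nlinarith [sq_nonneg (u i)]⟩
    have h2 : (fun l => z l + b / 2 * (1 + u l)) = y j := by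
      ext l; simp only [hu]; field_simp; ring
    rw [h2]
    calc _ ≤ |MvPolynomial.eval (y j) P| * 1 := by gcongr
      _ ≤ B := by simpa using hB j
  have h3 := abs_sub_abs_le_abs_sub (MvPolynomial.eval (fun l => z l + b / 2 * (1 + t l)) P * ∏ i, √(1 - t i ^ 2) ^ k)
    (MvPolynomial.eval (fun l => z l + b / 2 * (1 + u l)) P * ∏ i, √(1 - u i ^ 2) ^ k)
  rw [abs_sub_comm] at hbern
  have h4 : M - B ≤ N * M := by linarith
  have h5 : M ≤ 4 * (k + 1) * B := by
    have : M * (1 / (4 * (k + 1) : ℝ)) ≤ B := by rw [hN] at h4; linarith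
    rw [mul_one_div, div_le_iff₀ (by positivity)] at this
    linarith
  calc _ ≤ 4 ^ (n * k) * M := hxF
    _ ≤ 4 ^ (n * k) * (4 * (k + 1) * B) := by gcongr
    _ = _ := by ring

lemma prod_dist (i d : ℕ) : ∏ l ∈ (Finset.range (i + d + 1)).erase i, |(i : ℝ) - l| =
    (i.factorial : ℝ) * d.factorial := by
  induction d with
  | zero =>
    rw [add_zero, Finset.range_add_one, Finset.erase_insert (by simp), Nat.factorial_zero, Nat.cast_one,
      mul_one]
    rw [← Finset.prod_range_reflect, ← Finset.prod_range_add_one_eq_factorial, Nat.cast_prod]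
    refine Finset.prod_congr rfl fun l hl => ?_
    have hl' : l + 1 ≤ i := by simpa using hl
    have : ((i - 1 - l : ℕ) : ℝ) = i - 1 - l := by
      rw [Nat.cast_sub (by omega), Nat.cast_sub (by omega)]; simp
    rw [this, abs_of_nonneg (by linarith [(Nat.cast_nonneg l : (0:ℝ) ≤ l)])]
    push_cast; ring
  | succ d ih =>
    rw [show i + (d + 1) + 1 = (i + d + 1) + 1 by ring, Finset.range_add_one,
      Finset.erase_insert_of_ne (by omega), Finset.prod_insert (by simp), ih, Nat.factorial_succ]
    have : |(i : ℝ) - ((i + d + 1 : ℕ) : ℝ)| = d + 1 := by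
      rw [abs_sub_comm, abs_of_nonneg] <;> push_cast
      · ring
      · linarith [(Nat.cast_nonneg d : (0:ℝ) ≤ d)]
    rw [this]; push_cast; ring

lemma norming1 (k q : ℕ) (hq : 2 * (k + 1) ≤ q) (z b : ℝ) (hb : 0 < b) (y : Fin q → ℝ)
    (hy : ∀ j : Fin q, z + (j : ℝ) * (b / q) ≤ y j ∧ y j ≤ z + ((j : ℝ) + 1) * (b / q))
    (x : ℝ) (hx : z ≤ x ∧ x ≤ z + b) (p : Polynomial ℝ) (hp : p.natDegree ≤ k) (B : ℝ)
    (hB : ∀ j, |p.eval (y j)| ≤ B) : |p.eval x| ≤ Real.exp (4 * (k + 1)) * B := by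
  have hq0 : 0 < q := by omega
  have hq0' : (0 : ℝ) < q := by exact_mod_cast hq0
  have hB0 : 0 ≤ B := (abs_nonneg _).trans (hB ⟨0, hq0⟩)
  set m := q / (k + 1) with hm
  have hm2 : 2 ≤ m := by rw [hm, Nat.le_div_iff_mul_le (by omega)]; exact hq
  have hmq : m * (k + 1) ≤ q := Nat.div_mul_le_self _ _
  have hqm : q ≤ (m + 1) * (k + 1) := by
    have := Nat.lt_div_mul_add (a := q) (b := k + 1) (by omega)
    rw [← hm] at this; nlinarith
  let v : ℕ → ℝ := fun i => if h : i * m < q then y ⟨i * m, h⟩ else 0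
  have hlt : ∀ i ∈ Finset.range (k + 1), i * m < q := by
    intro i hi
    have : i ≤ k := by simpa [Nat.lt_succ_iff] using hi
    nlinarith
  have hv : ∀ i ∈ Finset.range (k + 1), z + ((i : ℝ) * m) * (b / q) ≤ v i ∧
      v i ≤ z + ((i : ℝ) * m + 1) * (b / q) ∧ |p.eval (v i)| ≤ B := by
    intro i hi
    simp only [v, dif_pos (hlt i hi)]
    have := hy ⟨i * m, hlt i hi⟩
    push_cast at this
    exact ⟨this.1, this.2, hB _⟩
  set h : ℝ := b / (3 * (k + 1)) with hh
  have hh0 : 0 < h := by positivity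
  have hm2' : (2 : ℝ) ≤ m := by exact_mod_cast hm2
  have hqm' : (q : ℝ) ≤ (m + 1) * (k + 1) := by exact_mod_cast hqm
  have hmh : h ≤ m / 2 * (b / q) := by
    rw [hh, div_mul_div_comm, div_le_div_iff₀ (by positivity) (by positivity)]
    have : (2 : ℝ) * q ≤ 3 * m * (k + 1) := by nlinarith [(Nat.cast_nonneg k : (0:ℝ) ≤ k)]
    nlinarith
  have hsep' : ∀ i ∈ Finset.range (k + 1), ∀ l ∈ Finset.range (k + 1), l < i →
      ((i : ℝ) - l) * h ≤ v i - v l := by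
    intro i hi l hl hli
    have h1 := (hv i hi).1
    have h2 := (hv l hl).2.1
    have h3 : (1 : ℝ) ≤ i - l := by
      have : ((l + 1 : ℕ) : ℝ) ≤ i := by exact_mod_cast hli
      push_cast at this; linarith
    have hbq : 0 < b / q := by positivity
    calc ((i : ℝ) - l) * h ≤ (i - l) * (m / 2 * (b / q)) := by gcongr
      _ = ((i - l) * (m / 2)) * (b / q) := by ring
      _ ≤ ((i - l) * m - 1) * (b / q) := by gcongr; nlinarith
      _ ≤ v i - v l := by linarith
  have hsep : ∀ i ∈ Finset.range (k + 1), ∀ l ∈ Finset.range (k + 1),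
      |(i : ℝ) - l| * h ≤ |v i - v l| := by
    intro i hi l hl
    rcases lt_trichotomy l i with hc | hc | hc
    · have h1 := hsep' i hi l hl hc
      have h2 : (0 : ℝ) ≤ i - l := by rw [sub_nonneg]; exact_mod_cast hc.le
      rw [abs_of_nonneg h2]; exact h1.trans (le_abs_self _)
    · subst hc; simp
    · have h1 := hsep' l hl i hi hc
      have h2 : (0 : ℝ) ≤ l - i := by rw [sub_nonneg]; exact_mod_cast hc.le
      rw [abs_sub_comm, abs_sub_comm (v i), abs_of_nonneg h2]; exact h1.trans (le_abs_self _)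
  have hinj : Set.InjOn v (Finset.range (k + 1) : Finset ℕ) := by
    intro i hi l hl hil
    by_contra hne
    have h1 := hsep i hi l hl
    rw [hil, sub_self, abs_zero] at h1
    have h2 : 0 < |(i : ℝ) - l| := abs_pos.mpr (sub_ne_zero.mpr (by exact_mod_cast hne))
    have := mul_pos h2 hh0
    linarith
  have hint := Lagrange.eq_interpolate (f := p) hinj (by
    rw [Finset.card_range]
    refine lt_of_le_of_lt Polynomial.degree_le_natDegree ?_
    exact_mod_cast Nat.lt_succ_of_le hp)
  have hbasis : ∀ i ∈ Finset.range (k + 1),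
      |(Lagrange.basis (Finset.range (k + 1)) v i).eval x| ≤ (3 * (k + 1)) ^ k * (2 ^ k / k.factorial) := by
    intro i hi
    have hik : i ≤ k := by simpa [Nat.lt_succ_iff] using hi
    rw [Lagrange.basis, Polynomial.eval_prod, Finset.abs_prod]
    have h1 : ∀ l ∈ (Finset.range (k + 1)).erase i,
        |(Lagrange.basisDivisor (v i) (v l)).eval x| ≤ (3 * (k + 1)) / |(i : ℝ) - l| := by
      intro l hl
      have hl' := Finset.mem_of_mem_erase hl
      have hne := Finset.ne_of_mem_erase hl
      have hpos : 0 < |(i : ℝ) - l| := abs_pos.mpr (sub_ne_zero.mpr (by exact_mod_cast hne.symm))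
      have hs := hsep i hi l hl'
      have hxv : |x - v l| ≤ b := by
        have e1 := (hv l hl').1
        have e2 := (hv l hl').2.1
        have e3 : 0 ≤ ((l : ℝ) * m) * (b / q) := by positivity
        have e4 : ((l : ℝ) * m + 1) * (b / q) ≤ b := by
          rw [← mul_div_assoc, div_le_iff₀ hq0', mul_comm]
          gcongr
          exact_mod_cast hlt l hl'
        rw [abs_le]; constructor <;> linarith
      have hvp : 0 < |v i - v l| := lt_of_lt_of_le (mul_pos hpos hh0) hs
      simp only [Lagrange.basisDivisor, Polynomial.eval_mul, Polynomial.eval_C, Polynomial.eval_sub,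
        Polynomial.eval_X]
      rw [abs_mul, abs_inv, inv_mul_eq_div, div_le_div_iff₀ hvp hpos]
      have hb3 : b = h * (3 * (k + 1)) := by rw [hh]; field_simp
      calc |x - v l| * |(i : ℝ) - l| ≤ b * |(i : ℝ) - l| := by gcongr
        _ = (3 * (k + 1)) * (|(i : ℝ) - l| * h) := by rw [hb3]; ring
        _ ≤ _ := by gcongr
    refine (Finset.prod_le_prod (fun _ _ => abs_nonneg _) h1).trans ?_
    rw [Finset.prod_div_distrib, Finset.prod_const, Finset.card_erase_of_mem hi, Finset.card_range,
      Nat.add_sub_cancel]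
    have h2 := prod_dist i (k - i)
    rw [show i + (k - i) = k by omega] at h2
    rw [h2, div_eq_mul_one_div]
    refine mul_le_mul_of_nonneg_left ?_ (by positivity)
    rw [div_le_div_iff₀ (by positivity) (by positivity), one_mul]
    have h3 := Nat.choose_mul_factorial_mul_factorial hik
    have h4 := Nat.choose_le_two_pow k i
    have : k.factorial ≤ 2 ^ k * (i.factorial * (k - i).factorial) := by
      rw [← h3, mul_assoc]; gcongr
    exact_mod_cast this
  have hsum : |p.eval x| ≤ (k + 1) * (B * ((3 * (k + 1)) ^ k * (2 ^ k / k.factorial))) := by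
    rw [hint, Lagrange.interpolate_apply, Polynomial.eval_finsetSum]
    refine (Finset.abs_sum_le_sum_abs _ _).trans ?_
    refine (Finset.sum_le_card_nsmul _ _ (B * ((3 * (k + 1)) ^ k * (2 ^ k / k.factorial))) ?_).trans ?_
    · intro i hi
      rw [Polynomial.eval_mul, Polynomial.eval_C, abs_mul]
      exact mul_le_mul (hv i hi).2.2 (hbasis i hi) (abs_nonneg _) hB0
    · simp
  refine hsum.trans ?_
  have e1 : ((k : ℝ) + 1) ^ k / k.factorial ≤ Real.exp (k + 1) :=
    Real.pow_div_factorial_le_exp _ (by positivity) k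
  have e2 : (6 : ℝ) ^ k ≤ Real.exp (2 * k) := by
    rw [mul_comm, Real.exp_nat_mul]
    gcongr
    have := Real.exp_one_gt_d9
    rw [show (2 : ℝ) = 1 + 1 by norm_num, Real.exp_add]
    nlinarith
  have e3 : (k : ℝ) + 1 ≤ Real.exp k := Real.add_one_le_exp _
  calc _ = ((k : ℝ) + 1) * 6 ^ k * (((k : ℝ) + 1) ^ k / k.factorial) * B := by
        rw [mul_pow, show (6 : ℝ) = 3 * 2 by norm_num, mul_pow]; ring
    _ ≤ Real.exp k * Real.exp (2 * k) * Real.exp (k + 1) * B := by gcongr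
    _ = Real.exp (4 * k + 1) * B := by rw [← Real.exp_add, ← Real.exp_add]; ring_nf
    _ ≤ _ := by gcongr; linarith

lemma gamma_ge_two (n : ℕ) : 2 ≤ gammaMN (n + 1) := by
  induction n with
  | zero => simp [gammaMN]
  | succ n ih =>
    rw [gammaMN]
    nlinarith [(Nat.cast_nonneg n : (0:ℝ) ≤ n)]

lemma gamma_ge_s1 (n : ℕ) (hn : 2 ≤ n) : 4 * ((n : ℝ) + 1) ≤ gammaMN n := by
  obtain ⟨m, rfl⟩ := Nat.exists_eq_add_of_le' hn
  rw [gammaMN]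
  have := gamma_ge_two m
  push_cast
  nlinarith [(Nat.cast_nonneg m : (0:ℝ) ≤ m)]

lemma norming_all (n : ℕ) (hn : 1 ≤ n) (k : ℕ) (q : ℕ)
    (hq : gammaMN n * (k + 1) ≤ (q : ℝ))
    (z : Fin n → ℝ) (b : ℝ) (hb : 0 < b)
    (y : (Fin n → Fin q) → (Fin n → ℝ))
    (hy : ∀ j : Fin n → Fin q, ∀ i : Fin n,
      z i + (j i : ℝ) * (b / q) ≤ y j i ∧ y j i ≤ z i + ((j i : ℝ) + 1) * (b / q))
    (x : Fin n → ℝ) (hx : ∀ i, z i ≤ x i ∧ x i ≤ z i + b)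
    (P : MvPolynomial (Fin n) ℝ) (hP : P.totalDegree ≤ k) (B : ℝ) (hB0 : 0 ≤ B)
    (hB : ∀ j, |MvPolynomial.eval (y j) P| ≤ B) :
    |MvPolynomial.eval x P| ≤ Real.exp (2 * n * gammaMN n * (k + 1)) * B := by
  rcases hn.lt_or_eq with h2 | rfl
  · have hg := gamma_ge_s1 n h2
    have hn' : (2 : ℝ) ≤ n := by exact_mod_cast h2
    have hk0 : (0 : ℝ) ≤ k := Nat.cast_nonneg k
    refine (norming n k h2 q (le_trans (by gcongr) hq) z b hb y hy x hx P hP B hB).trans ?_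
    gcongr
    have e4 : (4 : ℝ) ≤ Real.exp 2 := by
      have := Real.exp_one_gt_d9
      rw [show (2 : ℝ) = 1 + 1 by norm_num, Real.exp_add]
      nlinarith
    have e3 : (k : ℝ) + 1 ≤ Real.exp k := Real.add_one_le_exp _
    calc (4 : ℝ) ^ (n * k) * (4 * (k + 1)) ≤ Real.exp 2 ^ (n * k) * (Real.exp 2 * Real.exp k) := by gcongr
      _ = Real.exp (2 * (n * k) + 2 + k) := by
        rw [← Real.exp_nat_mul, ← Real.exp_add, ← Real.exp_add]; push_cast; ring_nf
      _ ≤ _ := by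
        apply Real.exp_le_exp.mpr
        have h5 : 2 * (n : ℝ) * 12 * (k + 1) ≤ 2 * n * gammaMN n * (k + 1) := by gcongr; linarith
        nlinarith [mul_nonneg (by linarith : (0:ℝ) ≤ n) hk0]
  · obtain ⟨p, hp, hpe⟩ := slice 1 k P hP (fun _ => -1) 2 x 0
    have hpe' : ∀ u : Fin 1 → ℝ, p.eval (u 0) = MvPolynomial.eval u P := by
      intro u
      rw [← hpe]
      congr 2
      ext l
      rw [Subsingleton.elim l 0]
      simp
    have hg : gammaMN 1 = 2 := rfl
    rw [hg] at hq ⊢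
    have := norming1 k q (by exact_mod_cast hq) (z 0) b hb (fun j => y (fun _ => j) 0)
      (fun j => hy (fun _ => j) 0) (x 0) (hx 0) p hp B (fun j => by rw [hpe']; exact hB _)
    rw [hpe'] at this
    refine this.trans (le_of_eq ?_)
    congr 2
    push_cast; ring

end helpers

/-- Let `Q = z + [0,b]^n` be a cube in `ℝ^n` of side `b > 0` subdivided into `q^n`
identical closed subcubes of side `b/q`, with `q ≥ γₙ(k+1)`, and let `y j` be a point
selected from the subcube indexed by `j ∈ {0,…,q−1}^n`.  Then for every `x ∈ Q` there
exist weights `w j` with `Σ_j w j · p(y j) = p(x)` for every polynomial `p` of total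
degree at most `k`, and `Σ_j |w j| ≤ e^{2nγₙ(k+1)}`. -/
theorem exists_representing_weights (n : ℕ) (hn : 1 ≤ n) (k : ℕ) (q : ℕ)
    (hq : gammaMN n * (k + 1) ≤ (q : ℝ))
    (z : Fin n → ℝ) (b : ℝ) (hb : 0 < b)
    (y : (Fin n → Fin q) → (Fin n → ℝ))
    (hy : ∀ j : Fin n → Fin q, ∀ i : Fin n,
      z i + (j i : ℝ) * (b / q) ≤ y j i ∧ y j i ≤ z i + ((j i : ℝ) + 1) * (b / q)) :
    ∀ x : Fin n → ℝ, (∀ i, z i ≤ x i ∧ x i ≤ z i + b) →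
      ∃ w : (Fin n → Fin q) → ℝ,
        (∀ p : MvPolynomial (Fin n) ℝ, p.totalDegree ≤ k →
          ∑ j : Fin n → Fin q, w j * MvPolynomial.eval (y j) p = MvPolynomial.eval x p) ∧
        ∑ j : Fin n → Fin q, |w j| ≤ Real.exp (2 * n * gammaMN n * (k + 1)) := by
  intro x hx
  let V := MvPolynomial.restrictTotalDegree (Fin n) ℝ k
  let E : (Fin n → ℝ) → (V →ₗ[ℝ] ℝ) := fun u =>
    ((MvPolynomial.aeval u : MvPolynomial (Fin n) ℝ →ₐ[ℝ] ℝ).toLinearMap).comp V.subtype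
  have hE : ∀ u (p : V), E u p = MvPolynomial.eval u (p : MvPolynomial (Fin n) ℝ) := by
    intro u p
    simp [E, MvPolynomial.aeval_eq_eval]
  obtain ⟨w, hw1, hw2⟩ := weights_of_norming (LinearMap.pi fun j => E (y j)) (E x)
    (Real.exp (2 * n * gammaMN n * (k + 1))) (Real.exp_pos _).le (by
      intro p
      rw [hE]
      refine norming_all n hn k q hq z b hb y hy x hx p
        ((MvPolynomial.mem_restrictTotalDegree _ _ _).mp p.2) _ (norm_nonneg _) ?_
      intro j
      have := norm_le_pi_norm ((LinearMap.pi fun j => E (y j)) p) j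
      rw [LinearMap.pi_apply, hE, Real.norm_eq_abs] at this
      exact this)
  refine ⟨w, fun p hp => ?_, hw2⟩
  have := hw1 ⟨p, (MvPolynomial.mem_restrictTotalDegree _ _ _).mpr hp⟩
  simpa only [LinearMap.pi_apply, hE] using this
end
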